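/- Suppose α : Ω → ℝ is piecewise constant with respect to P (constant on the interior of each cell) and α ≥ α_0 on Ω for some constant α_0 > 0. Then for every v in the trial space U_P^r, a_P(v, Πv) ≥ α_0 · |v|_1^2. -/

import Mathlib

open Polynomial MeasureTheory

noncomputable section

/-- `Leg r` is the `r`-th (formal) derivative of `(X² − 1)^r`, a nonzero scalar
multiple of the degree-`r` Legendre polynomial. -/
def Leg (r : ℕ) : Polynomial ℝ :=
  (fun p => Polynomial.derivative p)^[r] ((Polynomial.X ^ 2 - 1) ^ r)

/-- `G 1 < … < G r` are the Gauss points: the roots of `Leg r`, all in `(-1,1)`. -/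
def IsGaussPoints (r : ℕ) (G : ℕ → ℝ) : Prop :=
  (∀ k, 1 ≤ k → k < r → G k < G (k + 1)) ∧
  ∀ k, 1 ≤ k → k ≤ r → G k ∈ Set.Ioo (-1 : ℝ) 1 ∧ (Leg r).IsRoot (G k)

/-- `A k = ∫_{-1}^{1} ℓ_k` where `ℓ_k` is the Lagrange basis polynomial of degree
`≤ r - 1` at the Gauss points, i.e. `ℓ_k (G j) = δ_{jk}`. -/
def IsGaussWeights (r : ℕ) (G A : ℕ → ℝ) : Prop :=
  ∀ k, 1 ≤ k → k ≤ r → ∃ ℓ : Polynomial ℝ,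
    ℓ.natDegree ≤ r - 1 ∧
    (∀ j, 1 ≤ j → j ≤ r → ℓ.eval (G j) = if j = k then 1 else 0) ∧
    A k = ∫ x in (-1 : ℝ)..1, ℓ.eval x

/-- `Lob 0 = −1 < Lob 1 < … < Lob (r−1) < Lob r = 1` are the Lobatto points:
`±1` together with the roots of the derivative of `Leg r`. -/
def IsLobattoPoints (r : ℕ) (L : ℕ → ℝ) : Prop :=
  L 0 = -1 ∧ L r = 1 ∧ (∀ k < r, L k < L (k + 1)) ∧
  ∀ k, 1 ≤ k → k + 1 ≤ r → L k ∈ Set.Ioo (-1 : ℝ) 1 ∧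
    (Polynomial.derivative (Leg r)).IsRoot (L k)

/-- Cellwise partial derivative in the first (`x`) coordinate. -/
def pdx (f : ℝ × ℝ → ℝ) (z : ℝ × ℝ) : ℝ := fderiv ℝ f z (1, 0)

/-- Cellwise partial derivative in the second (`y`) coordinate. -/
def pdy (f : ℝ × ℝ → ℝ) (z : ℝ × ℝ) : ℝ := fderiv ℝ f z (0, 1)

/-- A rectangular partition of `Ω = [a,b] × [c,d]`:
`a = x₀ < x₁ < … < x_m = b`, `c = y₀ < y₁ < … < y_n = d`. -/
structure RectPartition (a b c d : ℝ) where
  m : ℕ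
  n : ℕ
  hm : 0 < m
  hn : 0 < n
  x : ℕ → ℝ
  y : ℕ → ℝ
  hxa : x 0 = a
  hxb : x m = b
  hyc : y 0 = c
  hyd : y n = d
  hxlt : ∀ i < m, x i < x (i + 1)
  hylt : ∀ j < n, y j < y (j + 1)

namespace RectPartition

variable {a b c d : ℝ}

/-- The domain `Ω = [a,b] × [c,d]`. -/
def dom (_P : RectPartition a b c d) : Set (ℝ × ℝ) := Set.Icc a b ×ˢ Set.Icc c d

/-- The boundary `∂Ω`. -/
def bdry (P : RectPartition a b c d) : Set (ℝ × ℝ) :=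
  P.dom \ (Set.Ioo a b ×ˢ Set.Ioo c d)

variable (P : RectPartition a b c d)

/-- Side length `h_i^x = x_i − x_{i−1}`. -/
def hx (i : ℕ) : ℝ := P.x i - P.x (i - 1)

/-- Side length `h_j^y = y_j − y_{j−1}`. -/
def hy (j : ℕ) : ℝ := P.y j - P.y (j - 1)

/-- The closed cell `τ_{i,j} = [x_{i−1}, x_i] × [y_{j−1}, y_j]`. -/
def cell (i j : ℕ) : Set (ℝ × ℝ) :=
  Set.Icc (P.x (i - 1)) (P.x i) ×ˢ Set.Icc (P.y (j - 1)) (P.y j)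

/-- The open cell `(x_{i−1}, x_i) × (y_{j−1}, y_j)`. -/
def openCell (i j : ℕ) : Set (ℝ × ℝ) :=
  Set.Ioo (P.x (i - 1)) (P.x i) ×ˢ Set.Ioo (P.y (j - 1)) (P.y j)

/-- The finite set of all side lengths of the partition. -/
def sides : Finset ℝ := ((Finset.Icc 1 P.m).image P.hx) ∪ ((Finset.Icc 1 P.n).image P.hy)

lemma sides_nonempty : P.sides.Nonempty :=
  ⟨P.hx 1, Finset.mem_union_left _
    (Finset.mem_image_of_mem _ (Finset.mem_Icc.mpr ⟨le_rfl, P.hm⟩))⟩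

/-- The mesh size `h`: the largest side length. -/
def meshSize : ℝ := P.sides.max' P.sides_nonempty

/-- `σ`-quasi-uniformity: every side length is at most `σ` times any other,
i.e. `h ≤ σ · min side`. -/
def QuasiUniform (σ : ℝ) : Prop := ∀ s ∈ P.sides, ∀ t ∈ P.sides, s ≤ σ * t

variable (r : ℕ) (G : ℕ → ℝ)

/-- The Gauss point `g^x_{i,k} = (x_i + x_{i−1} + h_i^x G_k)/2` for `1 ≤ k ≤ r`,
with the conventions `g^x_{i,r+1} = g^x_{i+1,1}` (for `i < m`) and `g^x_{m,r+1} = b`. -/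
def gx (i k : ℕ) : ℝ :=
  if k = r + 1 then
    (if i = P.m then P.x P.m
     else (P.x (i + 1) + P.x i + P.hx (i + 1) * G 1) / 2)
  else (P.x i + P.x (i - 1) + P.hx i * G k) / 2

/-- The Gauss point `g^y_{j,l}`, with the analogous conventions. -/
def gy (j l : ℕ) : ℝ :=
  if l = r + 1 then
    (if j = P.n then P.y P.n
     else (P.y (j + 1) + P.y j + P.hy (j + 1) * G 1) / 2)
  else (P.y j + P.y (j - 1) + P.hy j * G l) / 2

end RectPartition

/-- A function on `Ω` which is piecewise smooth with respect to the partition: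
a global function together with, for each cell, a (smooth) extension of its
restriction to the closed cell; cellwise derivatives are derivatives of the
cell functions. -/
structure PiecewiseFun {a b c d : ℝ} (P : RectPartition a b c d) where
  toFun : ℝ × ℝ → ℝ
  cellFun : ℕ → ℕ → ℝ × ℝ → ℝ
  agree : ∀ i ∈ Finset.Icc 1 P.m, ∀ j ∈ Finset.Icc 1 P.n, ∀ z ∈ P.cell i j,
    cellFun i j z = toFun z

namespace PiecewiseFun

variable {a b c d : ℝ} {P : RectPartition a b c d}

/-- Difference of two piecewise functions. -/
def sub (u v : PiecewiseFun P) : PiecewiseFun P where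
  toFun := fun z => u.toFun z - v.toFun z
  cellFun := fun i j z => u.cellFun i j z - v.cellFun i j z
  agree := fun i hi j hj z hz => by
    simp only [u.agree i hi j hj z hz, v.agree i hi j hj z hz]

end PiecewiseFun

/-- Cellwise `∂/∂x` of a piecewise function. -/
def cellDx {a b c d : ℝ} {P : RectPartition a b c d} (v : PiecewiseFun P) :
    ℕ → ℕ → ℝ × ℝ → ℝ := fun i j => pdx (v.cellFun i j)

/-- Cellwise `∂/∂y` of a piecewise function. -/
def cellDy {a b c d : ℝ} {P : RectPartition a b c d} (v : PiecewiseFun P) :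
    ℕ → ℕ → ℝ × ℝ → ℝ := fun i j => pdy (v.cellFun i j)

/-- `v` is `C^s` on each closed cell. -/
def CellSmooth {a b c d : ℝ} (P : RectPartition a b c d) (s : ℕ)
    (u : PiecewiseFun P) : Prop :=
  ∀ i ∈ Finset.Icc 1 P.m, ∀ j ∈ Finset.Icc 1 P.n, ContDiff ℝ s (u.cellFun i j)

/-- Evaluation of a bivariate polynomial (outer variable ↦ `x`, coefficients are
polynomials in `y`). -/
def evalXY (p : Polynomial (Polynomial ℝ)) (x y : ℝ) : ℝ :=
  (p.map (Polynomial.evalRingHom y)).eval x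

/-- `f` is (globally) a polynomial of degree `≤ r` in each of the two variables. -/
def IsBiPoly (r : ℕ) (f : ℝ × ℝ → ℝ) : Prop :=
  ∃ p : Polynomial (Polynomial ℝ), p.natDegree ≤ r ∧ (∀ k, (p.coeff k).natDegree ≤ r) ∧
    ∀ x y : ℝ, f (x, y) = evalXY p x y

/-- Membership in the trial space `U_P^r`: continuous on `Ω`, vanishing on `∂Ω`,
and a bi-degree `≤ r` polynomial on each cell. -/
def IsTrialFun {a b c d : ℝ} (r : ℕ) (P : RectPartition a b c d)
    (v : PiecewiseFun P) : Prop :=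
  ContinuousOn v.toFun P.dom ∧ (∀ z ∈ P.bdry, v.toFun z = 0) ∧
  ∀ i ∈ Finset.Icc 1 P.m, ∀ j ∈ Finset.Icc 1 P.n, IsBiPoly r (v.cellFun i j)

/-- The coefficients of a test function extended by the conventions
`w_{i,0;j,l} = w_{i−1,r;j,l}` (`0` if `i = 1`) and
`w_{i,k;j,0} = w_{i,k;j−1,r}` (`0` if `j = 1`). -/
def wE (r : ℕ) (w : ℕ → ℕ → ℕ → ℕ → ℝ) (i k j l : ℕ) : ℝ :=
  if (k = 0 ∧ i = 1) ∨ (l = 0 ∧ j = 1) then 0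
  else
    w (if k = 0 then i - 1 else i) (if k = 0 then r else k)
      (if l = 0 then j - 1 else j) (if l = 0 then r else l)

/-- The jump `[w]^x_{i,k;j,l} = w_{i,k;j,l} − w_{i,k−1;j,l}`. -/
def jumpX (r : ℕ) (w : ℕ → ℕ → ℕ → ℕ → ℝ) (i k j l : ℕ) : ℝ :=
  wE r w i k j l - wE r w i (k - 1) j l

/-- The jump `[w]^y_{i,k;j,l} = w_{i,k;j,l} − w_{i,k;j,l−1}`. -/
def jumpY (r : ℕ) (w : ℕ → ℕ → ℕ → ℕ → ℝ) (i k j l : ℕ) : ℝ :=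
  wE r w i k j l - wE r w i k j (l - 1)

/-- The double jump `⌊w⌋_{i,k;j,l}`. -/
def jumpXY (r : ℕ) (w : ℕ → ℕ → ℕ → ℕ → ℝ) (i k j l : ℕ) : ℝ :=
  wE r w i k j l - wE r w i (k - 1) j l - wE r w i k j (l - 1) + wE r w i (k - 1) j (l - 1)

/-- A test function: coefficients `w_{i,k;j,l}`, `1 ≤ i ≤ m`, `1 ≤ k ≤ r`,
`1 ≤ j ≤ n`, `1 ≤ l ≤ r`, vanishing for `(i,k) = (m,r)` or `(j,l) = (n,r)`. -/
def IsTestFun {a b c d : ℝ} (r : ℕ) (P : RectPartition a b c d)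
    (w : ℕ → ℕ → ℕ → ℕ → ℝ) : Prop :=
  (∀ j ∈ Finset.Icc 1 P.n, ∀ l ∈ Finset.Icc 1 r, w P.m r j l = 0) ∧
  (∀ i ∈ Finset.Icc 1 P.m, ∀ k ∈ Finset.Icc 1 r, w i k P.n r = 0)

/-- The index set `X`: quadruples `(i,k,j,l)` with `(j,l) ≠ (n,r)`. -/
def idxX {a b c d : ℝ} (r : ℕ) (P : RectPartition a b c d) : Finset (ℕ × ℕ × ℕ × ℕ) :=
  (Finset.Icc 1 P.m ×ˢ Finset.Icc 1 r ×ˢ Finset.Icc 1 P.n ×ˢ Finset.Icc 1 r).filter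
    fun q => ¬(q.2.2.1 = P.n ∧ q.2.2.2 = r)

/-- The index set `Y`: quadruples `(i,k,j,l)` with `(i,k) ≠ (m,r)`. -/
def idxY {a b c d : ℝ} (r : ℕ) (P : RectPartition a b c d) : Finset (ℕ × ℕ × ℕ × ℕ) :=
  (Finset.Icc 1 P.m ×ˢ Finset.Icc 1 r ×ˢ Finset.Icc 1 P.n ×ˢ Finset.Icc 1 r).filter
    fun q => ¬(q.1 = P.m ∧ q.2.1 = r)

/-- The index set of interior dual volumes: `(i,k) ≠ (m,r)` and `(j,l) ≠ (n,r)`. -/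
def idxZ {a b c d : ℝ} (r : ℕ) (P : RectPartition a b c d) : Finset (ℕ × ℕ × ℕ × ℕ) :=
  (Finset.Icc 1 P.m ×ˢ Finset.Icc 1 r ×ˢ Finset.Icc 1 P.n ×ˢ Finset.Icc 1 r).filter
    fun q => ¬(q.1 = P.m ∧ q.2.1 = r) ∧ ¬(q.2.2.1 = P.n ∧ q.2.2.2 = r)

/-- The dual-mesh seminorm `|w|_{P'}`. -/
def dualSemi {a b c d : ℝ} (r : ℕ) (P : RectPartition a b c d)
    (w : ℕ → ℕ → ℕ → ℕ → ℝ) : ℝ :=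
  Real.sqrt
    ((∑ q ∈ idxX r P, (jumpX r w q.1 q.2.1 q.2.2.1 q.2.2.2) ^ 2) +
     (∑ q ∈ idxY r P, (jumpY r w q.1 q.2.1 q.2.2.1 q.2.2.2) ^ 2))

/-- The FVM bilinear form `a_P(v, w)`, with the cellwise derivatives of `v`
given by `Dxv i j` and `Dyv i j` on cell `(i,j)`.  The integrals along Gauss
lines are split at the cell interfaces `y = y_j` (resp. `x = x_i`), which only
matters for the last Gauss subinterval `l = r` (resp. `k = r`). -/
def aP {a b c d : ℝ} (r : ℕ) (G : ℕ → ℝ) (P : RectPartition a b c d)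
    (α : ℝ × ℝ → ℝ) (Dxv Dyv : ℕ → ℕ → ℝ × ℝ → ℝ) (w : ℕ → ℕ → ℕ → ℕ → ℝ) : ℝ :=
  (∑ q ∈ idxX r P,
    jumpX r w q.1 q.2.1 q.2.2.1 q.2.2.2 *
      ((∫ t in (P.gy r G q.2.2.1 q.2.2.2)..(min (P.gy r G q.2.2.1 (q.2.2.2 + 1)) (P.y q.2.2.1)),
          α (P.gx r G q.1 q.2.1, t) * Dxv q.1 q.2.2.1 (P.gx r G q.1 q.2.1, t)) +
       (∫ t in (P.y q.2.2.1)..(max (P.gy r G q.2.2.1 (q.2.2.2 + 1)) (P.y q.2.2.1)),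
          α (P.gx r G q.1 q.2.1, t) * Dxv q.1 (q.2.2.1 + 1) (P.gx r G q.1 q.2.1, t)))) +
  (∑ q ∈ idxY r P,
    jumpY r w q.1 q.2.1 q.2.2.1 q.2.2.2 *
      ((∫ t in (P.gx r G q.1 q.2.1)..(min (P.gx r G q.1 (q.2.1 + 1)) (P.x q.1)),
          α (t, P.gy r G q.2.2.1 q.2.2.2) * Dyv q.1 q.2.2.1 (t, P.gy r G q.2.2.1 q.2.2.2)) +
       (∫ t in (P.x q.1)..(max (P.gx r G q.1 (q.2.1 + 1)) (P.x q.1)),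
          α (t, P.gy r G q.2.2.1 q.2.2.2) * Dyv (q.1 + 1) q.2.2.1 (t, P.gy r G q.2.2.1 q.2.2.2))))

/-- The broken `H¹` seminorm `|v|₁` computed cellwise. -/
def semiH1 {a b c d : ℝ} (P : RectPartition a b c d) (v : PiecewiseFun P) : ℝ :=
  Real.sqrt (∑ i ∈ Finset.Icc 1 P.m, ∑ j ∈ Finset.Icc 1 P.n,
    ∫ z in P.cell i j, ((cellDx v i j z) ^ 2 + (cellDy v i j z) ^ 2))

/-- The mesh-dependent seminorm `|v|_P` (broken `H²`-type seminorm). -/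
def semiP {a b c d : ℝ} (P : RectPartition a b c d) (v : PiecewiseFun P) : ℝ :=
  Real.sqrt (∑ i ∈ Finset.Icc 1 P.m, ∑ j ∈ Finset.Icc 1 P.n,
    ((∫ z in P.cell i j, ((cellDx v i j z) ^ 2 + (cellDy v i j z) ^ 2)) +
      (P.hx i ^ 2 + P.hy j ^ 2) *
        ∫ z in P.cell i j,
          ((pdx (pdx (v.cellFun i j)) z) ^ 2 + 2 * (pdy (pdx (v.cellFun i j)) z) ^ 2 +
            (pdy (pdy (v.cellFun i j)) z) ^ 2)))

/-- The broken seminorm `|u|_{s,P}`. -/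
def brokenSemi {a b c d : ℝ} (P : RectPartition a b c d) (u : PiecewiseFun P) (s : ℕ) : ℝ :=
  Real.sqrt (∑ i ∈ Finset.Icc 1 P.m, ∑ j ∈ Finset.Icc 1 P.n, ∑ t ∈ Finset.range (s + 1),
    ∫ z in P.cell i j, (pdx^[t] (pdy^[s - t] (u.cellFun i j)) z) ^ 2)

/-- The broken norm `‖u‖_{s,P} = (Σ_{t=0}^{s} |u|_{t,P}²)^{1/2}`. -/
def brokenNorm {a b c d : ℝ} (P : RectPartition a b c d) (u : PiecewiseFun P) (s : ℕ) : ℝ :=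
  Real.sqrt (∑ t ∈ Finset.range (s + 1), (brokenSemi P u t) ^ 2)

/-- `w = Πv`: the test function determined by the double-jump constraints
`⌊Πv⌋_{i,k;j,l} = A^x_{i,k} A^y_{j,l} ∂²v/∂x∂y(g^x_{i,k}, g^y_{j,l})`. -/
def IsPiOf {a b c d : ℝ} (r : ℕ) (G A : ℕ → ℝ) (P : RectPartition a b c d)
    (v : PiecewiseFun P) (w : ℕ → ℕ → ℕ → ℕ → ℝ) : Prop :=
  IsTestFun r P w ∧
  ∀ i ∈ Finset.Icc 1 P.m, ∀ k ∈ Finset.Icc 1 r, ∀ j ∈ Finset.Icc 1 P.n, ∀ l ∈ Finset.Icc 1 r,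
    ¬(i = P.m ∧ k = r) → ¬(j = P.n ∧ l = r) →
    jumpXY r w i k j l =
      (P.hx i * A k / 2) * (P.hy j * A l / 2) *
        pdy (pdx (v.cellFun i j)) (P.gx r G i k, P.gy r G j l)

/-- `α` is piecewise constant with respect to `P`. -/
def PiecewiseConstant {a b c d : ℝ} (P : RectPartition a b c d) (α : ℝ × ℝ → ℝ) : Prop :=
  ∀ i ∈ Finset.Icc 1 P.m, ∀ j ∈ Finset.Icc 1 P.n, ∃ cst : ℝ, ∀ z ∈ P.openCell i j, α z = cst

/-- The cellwise fluxes `α ∂u/∂x`, `α ∂u/∂y` extend continuously to `Ω`. -/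
def FluxContinuous {a b c d : ℝ} (P : RectPartition a b c d) (α : ℝ × ℝ → ℝ)
    (u : PiecewiseFun P) : Prop :=
  ∃ Fx Fy : ℝ × ℝ → ℝ, ContinuousOn Fx P.dom ∧ ContinuousOn Fy P.dom ∧
    ∀ i ∈ Finset.Icc 1 P.m, ∀ j ∈ Finset.Icc 1 P.n, ∀ z ∈ P.openCell i j,
      Fx z = α z * cellDx u i j z ∧ Fy z = α z * cellDy u i j z

/-- The iterated integral of `f` over the rectangle `[x₁,x₂] × [y₁,y₂]`. -/
def rectInt (f : ℝ × ℝ → ℝ) (x₁ x₂ y₁ y₂ : ℝ) : ℝ :=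
  ∫ s in x₁..x₂, ∫ t in y₁..y₂, f (s, t)

/-- The integral over the dual volume `τ'_{i,k;j,l} = [g^x_{i,k}, g^x_{i,k+1}] ×
[g^y_{j,l}, g^y_{j,l+1}]` of a cellwise-defined integrand `F i j`, split along
the cell interfaces `x = x_i` and `y = y_j`. -/
def dualCellInt {a b c d : ℝ} (r : ℕ) (G : ℕ → ℝ) (P : RectPartition a b c d)
    (F : ℕ → ℕ → ℝ × ℝ → ℝ) (i k j l : ℕ) : ℝ :=
  rectInt (F i j) (P.gx r G i k) (min (P.gx r G i (k + 1)) (P.x i))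
    (P.gy r G j l) (min (P.gy r G j (l + 1)) (P.y j)) +
  rectInt (F (i + 1) j) (P.x i) (max (P.gx r G i (k + 1)) (P.x i))
    (P.gy r G j l) (min (P.gy r G j (l + 1)) (P.y j)) +
  rectInt (F i (j + 1)) (P.gx r G i k) (min (P.gx r G i (k + 1)) (P.x i))
    (P.y j) (max (P.gy r G j (l + 1)) (P.y j)) +
  rectInt (F (i + 1) (j + 1)) (P.x i) (max (P.gx r G i (k + 1)) (P.x i))
    (P.y j) (max (P.gy r G j (l + 1)) (P.y j))

/-- The cellwise source term `f = −α (∂²u/∂x² + ∂²u/∂y²)` (for piecewise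
constant `α`). -/
def cellSource {a b c d : ℝ} {P : RectPartition a b c d} (α : ℝ × ℝ → ℝ)
    (u : PiecewiseFun P) (i j : ℕ) (z : ℝ × ℝ) : ℝ :=
  -(α z * (pdx (pdx (u.cellFun i j)) z + pdy (pdy (u.cellFun i j)) z))

/-- The right-hand side `Σ w_{i,k;j,l} ∫_{τ'_{i,k;j,l}} f` of the FV scheme. -/
def fvRHS {a b c d : ℝ} (r : ℕ) (G : ℕ → ℝ) (P : RectPartition a b c d)
    (α : ℝ × ℝ → ℝ) (u : PiecewiseFun P) (w : ℕ → ℕ → ℕ → ℕ → ℝ) : ℝ :=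
  ∑ q ∈ idxZ r P, w q.1 q.2.1 q.2.2.1 q.2.2.2 *
    dualCellInt r G P (cellSource α u) q.1 q.2.1 q.2.2.1 q.2.2.2

/-- `uP` is a finite volume solution for the exact solution `u`. -/
def IsFVSolution {a b c d : ℝ} (r : ℕ) (G : ℕ → ℝ) (P : RectPartition a b c d)
    (α : ℝ × ℝ → ℝ) (u uP : PiecewiseFun P) : Prop :=
  IsTrialFun r P uP ∧
  ∀ w, IsTestFun r P w → aP r G P α (cellDx uP) (cellDy uP) w = fvRHS r G P α u w

/-- The Lobatto node in cell `(i,j)` with 0-based indices `0 ≤ k, l ≤ r`. -/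
def lobattoNode {a b c d : ℝ} (P : RectPartition a b c d) (L : ℕ → ℝ)
    (i j k l : ℕ) : ℝ × ℝ :=
  ((P.x (i - 1) + P.x i + P.hx i * L k) / 2, (P.y (j - 1) + P.y j + P.hy j * L l) / 2)

/-- `uI` is the Lobatto interpolant of `u` in the trial space `U_P^r`. -/
def IsLobattoInterp {a b c d : ℝ} (r : ℕ) (L : ℕ → ℝ) (P : RectPartition a b c d)
    (u : ℝ × ℝ → ℝ) (uI : PiecewiseFun P) : Prop :=
  IsTrialFun r P uI ∧
  ∀ i ∈ Finset.Icc 1 P.m, ∀ j ∈ Finset.Icc 1 P.n,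
    ∀ k ∈ Finset.Icc 0 r, ∀ l ∈ Finset.Icc 0 r,
      uI.toFun (lobattoNode P L i j k l) = u (lobattoNode P L i j k l)

/-- The piecewise oscillation `osc_P(α)`: the maximum over all cells of
`ess sup α − ess inf α`. -/
def oscP {a b c d : ℝ} (P : RectPartition a b c d) (α : ℝ × ℝ → ℝ) : ℝ :=
  (Finset.Icc 1 P.m ×ˢ Finset.Icc 1 P.n).sup'
    (Finset.Nonempty.product (Finset.nonempty_Icc.mpr P.hm) (Finset.nonempty_Icc.mpr P.hn))
    fun p => essSup α (volume.restrict (P.cell p.1 p.2)) -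
      essInf α (volume.restrict (P.cell p.1 p.2))

end


section GaussQuadrature

lemma isRoot_iterate_derivative_sq_sub_one_pow {r s : ℕ} (hs : s < r) {t : ℝ}
    (ht : t ^ 2 = 1) :
    ((fun p : ℝ[X] => derivative p)^[s] ((X ^ 2 - 1) ^ r)).eval t = 0 := by
  have hdvd : (X - C t) ^ r ∣ ((X ^ 2 - 1) ^ r : ℝ[X]) := by
    apply pow_dvd_pow_of_dvd
    rw [dvd_iff_isRoot]
    simp [ht]
  have h := pow_sub_dvd_iterate_derivative_of_pow_dvd s hdvd
  have h2 : (X - C t) ∣ derivative^[s] ((X ^ 2 - 1) ^ r : ℝ[X]) :=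
    (dvd_pow_self _ (by omega)).trans h
  exact dvd_iff_isRoot.mp h2

lemma intervalIntegrable_eval (p : ℝ[X]) (a b : ℝ) :
    IntervalIntegrable (fun t => p.eval t) volume a b :=
  p.continuous.intervalIntegrable _ _

lemma integral_eval_derivative (p : ℝ[X]) (a b : ℝ) :
    ∫ t in a..b, (derivative p).eval t = p.eval b - p.eval a :=
  intervalIntegral.integral_eq_sub_of_hasDerivAt (fun t _ => p.hasDerivAt t)
    (intervalIntegrable_eval _ _ _)

lemma integral_eval_sub (p q : ℝ[X]) (a b : ℝ) :
    ∫ t in a..b, (p - q).eval t = (∫ t in a..b, p.eval t) - ∫ t in a..b, q.eval t := by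
  simp only [eval_sub]
  exact intervalIntegral.integral_sub (intervalIntegrable_eval _ _ _)
    (intervalIntegrable_eval _ _ _)

lemma integral_eval_add (p q : ℝ[X]) (a b : ℝ) :
    ∫ t in a..b, (p + q).eval t = (∫ t in a..b, p.eval t) + ∫ t in a..b, q.eval t := by
  simp only [eval_add]
  exact intervalIntegral.integral_add (intervalIntegrable_eval _ _ _)
    (intervalIntegrable_eval _ _ _)

lemma integral_eval_mul_derivative (p q : ℝ[X]) (a b : ℝ) :
    ∫ t in a..b, (derivative p * q).eval t =
      p.eval b * q.eval b - p.eval a * q.eval a - ∫ t in a..b, (p * derivative q).eval t := by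
  have h := integral_eval_derivative (p * q) a b
  rw [derivative_mul, integral_eval_add, eval_mul, eval_mul] at h
  linarith

/-- Iterated derivatives of `(X² - 1) ^ r` are orthogonal to lower-degree polynomials. -/
lemma integral_iterate_derivative_mul_eq_zero (r s : ℕ) (hs : s ≤ r) (q : ℝ[X])
    (hq : q.degree < s) :
    ∫ t in (-1 : ℝ)..1,
      ((fun p : ℝ[X] => derivative p)^[s] ((X ^ 2 - 1) ^ r) * q).eval t = 0 := by
  induction s generalizing q with
  | zero =>
    have : q = 0 := by
      rw [← degree_eq_bot]
      simpa [Nat.WithBot.lt_zero_iff] using hq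
    simp [this]
  | succ s ih =>
    rw [Function.iterate_succ_apply', integral_eval_mul_derivative,
      isRoot_iterate_derivative_sq_sub_one_pow (by omega) (by norm_num),
      isRoot_iterate_derivative_sq_sub_one_pow (by omega) (by norm_num), ih (by omega)]
    · simp
    · rcases eq_or_ne q 0 with rfl | h0
      · simp
      · have h1 := degree_derivative_lt h0
        rw [degree_eq_natDegree h0] at h1 hq
        have h2 : q.natDegree ≤ s := by
          have : q.natDegree < s + 1 := by exact_mod_cast hq
          omega
        exact lt_of_lt_of_le h1 (by exact_mod_cast h2)

lemma natDegree_Leg_le (r : ℕ) : (Leg r).natDegree ≤ r := by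
  have h := natDegree_iterate_derivative ((X ^ 2 - 1 : ℝ[X]) ^ r) r
  have h2 : ((X ^ 2 - 1 : ℝ[X]) ^ r).natDegree ≤ r * 2 :=
    natDegree_pow_le_of_le r (by compute_degree)
  exact h.trans (by omega)

lemma coeff_Leg_ne_zero (r : ℕ) : (Leg r).coeff r ≠ 0 := by
  have h : (Leg r).coeff r = ((r + r).descFactorial r) • ((X ^ 2 - 1 : ℝ[X]) ^ r).coeff (r + r) :=
    coeff_iterate_derivative _ _
  have h2 : ((X ^ 2 - 1 : ℝ[X]) ^ r).coeff (r + r) = 1 := by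
    have hm : (X ^ 2 - 1 : ℝ[X]).Monic := by monicity!
    have hd : (X ^ 2 - 1 : ℝ[X]).natDegree = 2 := by compute_degree!
    have := (hm.pow r).coeff_natDegree
    rwa [hm.natDegree_pow, hd, mul_two] at this
  rw [h, h2, nsmul_one]
  exact_mod_cast (Nat.descFactorial_pos.mpr (by omega)).ne'

lemma natDegree_Leg (r : ℕ) : (Leg r).natDegree = r :=
  natDegree_eq_of_le_of_coeff_ne_zero (natDegree_Leg_le r) (coeff_Leg_ne_zero r)

lemma integral_Leg_mul_eq_zero (r : ℕ) (q : ℝ[X]) (hq : q.degree < r) :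
    ∫ t in (-1 : ℝ)..1, (Leg r * q).eval t = 0 :=
  integral_iterate_derivative_mul_eq_zero r r le_rfl q hq

lemma IsGaussPoints.strictMonoOn {r : ℕ} {G : ℕ → ℝ} (hG : IsGaussPoints r G) {k l : ℕ}
    (hk : 1 ≤ k) (hkl : k < l) (hl : l ≤ r) : G k < G l := by
  induction l, hkl using Nat.le_induction with
  | base => exact hG.1 k hk (by omega)
  | succ l hkl ih => exact (ih (by omega)).trans (hG.1 l (by omega) (by omega))

lemma IsGaussPoints.injOn {r : ℕ} {G : ℕ → ℝ} (hG : IsGaussPoints r G) :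
    Set.InjOn G (Finset.Icc 1 r) := by
  intro k hk l hl h
  simp only [Finset.coe_Icc, Set.mem_Icc] at hk hl
  by_contra hne
  rcases lt_or_gt_of_ne hne with h1 | h1
  · exact (hG.strictMonoOn hk.1 h1 hl.2).ne h
  · exact (hG.strictMonoOn hl.1 h1 hk.2).ne' h

lemma integral_eval_sum {ι : Type*} (s : Finset ι) (p : ι → ℝ[X]) (a b : ℝ) :
    ∫ t in a..b, (∑ k ∈ s, p k).eval t = ∑ k ∈ s, ∫ t in a..b, (p k).eval t := by
  simp only [eval_finsetSum]
  exact intervalIntegral.integral_finsetSum fun k _ => intervalIntegrable_eval _ _ _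

lemma integral_eval_C_mul (c : ℝ) (p : ℝ[X]) (a b : ℝ) :
    ∫ t in a..b, (C c * p).eval t = c * ∫ t in a..b, p.eval t := by
  simp only [eval_mul, eval_C, intervalIntegral.integral_const_mul]

/-- The quadrature is interpolatory. -/
lemma gauss_quadrature_of_degree_lt {r : ℕ} {G A : ℕ → ℝ} (hG : IsGaussPoints r G)
    (hA : IsGaussWeights r G A) (p : ℝ[X]) (hp : p.degree < r) :
    ∑ k ∈ Finset.Icc 1 r, A k * p.eval (G k) = ∫ t in (-1 : ℝ)..1, p.eval t := by
  choose! ℓ hdeg heval hint using hA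
  have hdeg' : ∀ k, 1 ≤ k → k ≤ r → (ℓ k).degree < r := fun k h1 h2 =>
    lt_of_le_of_lt degree_le_natDegree (by
      have := hdeg k h1 h2
      exact_mod_cast (show (ℓ k).natDegree < r by omega))
  have hp_eq : p = ∑ k ∈ Finset.Icc 1 r, C (p.eval (G k)) * ℓ k := by
    refine eq_of_degrees_lt_of_eval_index_eq (s := Finset.Icc 1 r) (v := G) hG.injOn
      (by simpa using hp) ?_ ?_
    · rw [Nat.card_Icc, Nat.add_sub_cancel]
      refine lt_of_le_of_lt (degree_sum_le _ _) ?_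
      refine (Finset.sup_lt_iff (WithBot.bot_lt_coe r)).mpr fun k hk => ?_
      rw [Finset.mem_Icc] at hk
      rw [← smul_eq_C_mul]
      exact lt_of_le_of_lt (degree_smul_le _ _) (hdeg' k hk.1 hk.2)
    · intro j hj
      rw [eval_finsetSum, Finset.sum_eq_single j]
      · rw [Finset.mem_Icc] at hj
        simp [heval j hj.1 hj.2 j hj.1 hj.2]
      · intro k hk hkj
        rw [Finset.mem_Icc] at hj hk
        simp [heval k hk.1 hk.2 j hj.1 hj.2, hkj.symm]
      · exact fun h => absurd hj h
  conv_rhs => rw [hp_eq]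
  rw [integral_eval_sum]
  refine Finset.sum_congr rfl fun k hk => ?_
  rw [Finset.mem_Icc] at hk
  rw [integral_eval_C_mul, hint k hk.1 hk.2, mul_comm]

/-- The `r`-point Gauss rule is exact on polynomials of degree less than `2 r`. -/
lemma gauss_quadrature_exact {r : ℕ} {G A : ℕ → ℝ} (hG : IsGaussPoints r G)
    (hA : IsGaussWeights r G A) (p : ℝ[X]) (hp : p.natDegree < 2 * r) :
    ∑ k ∈ Finset.Icc 1 r, A k * p.eval (G k) = ∫ t in (-1 : ℝ)..1, p.eval t := by
  have hL0 : Leg r ≠ 0 := fun h => coeff_Leg_ne_zero r (by simp [h])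
  have hdegL : (Leg r).degree = r := by rw [degree_eq_natDegree hL0, natDegree_Leg]
  have hdiv : Leg r * (p / Leg r) + p % Leg r = p := EuclideanDomain.div_add_mod p (Leg r)
  have hmod : (p % Leg r).degree < r := hdegL ▸ EuclideanDomain.mod_lt p hL0
  have hq : (p / Leg r).degree < r := by
    refine lt_of_le_of_lt degree_le_natDegree ?_
    rcases eq_or_ne (p / Leg r) 0 with h0 | h0
    · rw [h0, natDegree_zero]
      exact_mod_cast (show 0 < r by omega)
    · have hle : (Leg r).degree ≤ p.degree :=
        not_lt.mp fun h => h0 ((Polynomial.div_eq_zero_iff hL0).mpr h)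
      have hadd := degree_add_div hL0 hle
      have hp0 : p ≠ 0 := by rintro rfl; simp at h0
      rw [hdegL, degree_eq_natDegree h0, degree_eq_natDegree hp0] at hadd
      have hadd' : r + (p / Leg r).natDegree = p.natDegree := by exact_mod_cast hadd
      exact_mod_cast (show (p / Leg r).natDegree < r by omega)
  have hpt : ∀ k ∈ Finset.Icc 1 r, A k * p.eval (G k) = A k * (p % Leg r).eval (G k) := by
    intro k hk
    rw [Finset.mem_Icc] at hk
    have hroot : (Leg r).eval (G k) = 0 := (hG.2 k hk.1 hk.2).2
    conv_lhs => rw [← hdiv]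
    simp [hroot]
  rw [Finset.sum_congr rfl hpt, gauss_quadrature_of_degree_lt hG hA _ hmod]
  conv_rhs => rw [← hdiv]
  rw [integral_eval_add, integral_Leg_mul_eq_zero r _ hq, zero_add]

lemma gauss_weight_nonneg {r : ℕ} {G A : ℕ → ℝ} (hG : IsGaussPoints r G)
    (hA : IsGaussWeights r G A) {k : ℕ} (h1 : 1 ≤ k) (h2 : k ≤ r) : 0 ≤ A k := by
  obtain ⟨ℓ, hdeg, heval, -⟩ := hA k h1 h2
  have hex := gauss_quadrature_exact hG hA (ℓ ^ 2)
    (lt_of_le_of_lt natDegree_pow_le (by omega))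
  rw [Finset.sum_eq_single k] at hex
  · have : A k = ∫ t in (-1 : ℝ)..1, (ℓ ^ 2).eval t := by
      rw [← hex]
      simp [heval k h1 h2]
    rw [this]
    refine intervalIntegral.integral_nonneg (by norm_num) fun t _ => ?_
    rw [eval_pow]
    positivity
  · intro j hj hjk
    rw [Finset.mem_Icc] at hj
    simp [heval j hj.1 hj.2, hjk]
  · intro h
    exact absurd (Finset.mem_Icc.mpr ⟨h1, h2⟩) h

/-- The Gauss rule underestimates the integral of `φ' F` when `F' = κ φ` and `κ ≥ 0`. -/
lemma gauss_quadrature_derivative_mul_le {r : ℕ} (hr : 1 ≤ r) {G A : ℕ → ℝ}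
    (hG : IsGaussPoints r G) (hA : IsGaussWeights r G A) (φ F : ℝ[X]) (κ : ℝ) (hκ : 0 ≤ κ)
    (hφ : φ.natDegree ≤ r) (hF : derivative F = C κ * φ) :
    ∑ k ∈ Finset.Icc 1 r, A k * (derivative φ * F).eval (G k) ≤
      ∫ t in (-1 : ℝ)..1, (derivative φ * F).eval t := by
  have hdF : F.natDegree ≤ r + 1 := by
    have h1 : (derivative F).natDegree ≤ r := by
      rw [hF]; exact (natDegree_C_mul_le _ _).trans hφ
    by_contra h
    push Not at h
    have h2 : (derivative F).coeff (F.natDegree - 1) = 0 :=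
      coeff_eq_zero_of_natDegree_lt (by omega)
    rw [coeff_derivative, Nat.sub_add_cancel (by omega)] at h2
    rcases mul_eq_zero.mp h2 with h3 | h3
    · have : F ≠ 0 := by rintro rfl; simp at h
      exact this (leadingCoeff_eq_zero.mp h3)
    · have : (0 : ℝ) < ((F.natDegree - 1 : ℕ) : ℝ) + 1 := by positivity
      linarith
  have hdφ : (derivative φ).natDegree ≤ r - 1 :=
    (natDegree_derivative_le φ).trans (by omega)
  set g := derivative φ * F with hg
  have hdg : g.natDegree ≤ 2 * r := natDegree_mul_le.trans (by omega)
  have hcg : g.coeff (2 * r) = (derivative φ).coeff (r - 1) * F.coeff (r + 1) := by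
    rw [hg, show 2 * r = (r - 1) + (r + 1) by omega]
    exact coeff_mul_add_eq_of_natDegree_le hdφ hdF
  have hcφ : (derivative φ).coeff (r - 1) = φ.coeff r * r := by
    rw [coeff_derivative, Nat.sub_add_cancel hr]
    congr 1
    exact_mod_cast Nat.sub_add_cancel hr
  have hcF : F.coeff (r + 1) * ((r : ℝ) + 1) = κ * φ.coeff r := by
    rw [← coeff_derivative, hF, coeff_C_mul]
  have hnonneg : 0 ≤ g.coeff (2 * r) := by
    have hpos : (0 : ℝ) < (r : ℝ) + 1 := by positivity
    have : F.coeff (r + 1) = κ * φ.coeff r / ((r : ℝ) + 1) := by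
      rw [eq_div_iff hpos.ne', hcF]
    rw [hcg, hcφ, this]
    have : φ.coeff r * r * (κ * φ.coeff r / ((r : ℝ) + 1)) =
        κ * r * (φ.coeff r) ^ 2 / ((r : ℝ) + 1) := by ring
    rw [this]
    positivity
  set μ := g.coeff (2 * r) / ((Leg r).coeff r) ^ 2 with hμ
  have hμ0 : 0 ≤ μ := by positivity
  have hL2 : (Leg r * Leg r).coeff (2 * r) = ((Leg r).coeff r) ^ 2 := by
    rw [two_mul, coeff_mul_add_eq_of_natDegree_le (natDegree_Leg_le r) (natDegree_Leg_le r), sq]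
  have hd : (g - C μ * (Leg r * Leg r)).natDegree < 2 * r := by
    have hle : (g - C μ * (Leg r * Leg r)).natDegree ≤ 2 * r := by
      refine (natDegree_sub_le _ _).trans (max_le hdg ((natDegree_C_mul_le _ _).trans ?_))
      exact natDegree_mul_le.trans (by rw [natDegree_Leg]; omega)
    refine lt_of_le_of_ne hle fun heq => ?_
    have hzero : (g - C μ * (Leg r * Leg r)).coeff (2 * r) = 0 := by
      rw [coeff_sub, coeff_C_mul, hL2, hμ]
      have := coeff_Leg_ne_zero r
      field_simp
      ring
    rw [← heq] at hzero
    have h0 := leadingCoeff_eq_zero.mp hzero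
    rw [h0, natDegree_zero] at heq
    omega
  have hex := gauss_quadrature_exact hG hA _ hd
  have hpt : ∀ k ∈ Finset.Icc 1 r,
      A k * (g - C μ * (Leg r * Leg r)).eval (G k) = A k * g.eval (G k) := by
    intro k hk
    rw [Finset.mem_Icc] at hk
    have hroot : (Leg r).eval (G k) = 0 := (hG.2 k hk.1 hk.2).2
    simp [hroot]
  rw [Finset.sum_congr rfl hpt, integral_eval_sub, integral_eval_C_mul] at hex
  have hLnn : 0 ≤ ∫ t in (-1 : ℝ)..1, (Leg r * Leg r).eval t := by
    refine intervalIntegral.integral_nonneg (by norm_num) fun t _ => ?_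
    rw [eval_mul]
    exact mul_self_nonneg _
  rw [hex]
  have := mul_nonneg hμ0 hLnn
  linarith

lemma integral_eval_comp_affine (p : ℝ[X]) (u v : ℝ) :
    (v - u) / 2 * ∫ t in (-1 : ℝ)..1,
      (p.comp (C ((v + u) / 2) + C ((v - u) / 2) * X)).eval t = ∫ t in u..v, p.eval t := by
  simp only [eval_comp, eval_add, eval_mul, eval_C, eval_X]
  rw [intervalIntegral.mul_integral_comp_add_mul (f := fun t => p.eval t)]
  congr 1 <;> ring

/-- Exactness of the Gauss rule transported to an interval `[u, v]`. -/
lemma gauss_quadrature_exact_interval {r : ℕ} {G A : ℕ → ℝ} (hG : IsGaussPoints r G)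
    (hA : IsGaussWeights r G A) (p : ℝ[X]) (hp : p.natDegree < 2 * r) (u v : ℝ) :
    ∑ k ∈ Finset.Icc 1 r, (v - u) * A k / 2 * p.eval ((v + u + (v - u) * G k) / 2) =
      ∫ t in u..v, p.eval t := by
  have haff : (C ((v + u) / 2) + C ((v - u) / 2) * X : ℝ[X]).natDegree ≤ 1 := by compute_degree
  have hex := gauss_quadrature_exact hG hA (p.comp (C ((v + u) / 2) + C ((v - u) / 2) * X))
    (lt_of_le_of_lt natDegree_comp_le
      (lt_of_le_of_lt (Nat.mul_le_mul_left _ haff) (by omega)))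
  rw [← integral_eval_comp_affine, ← hex, Finset.mul_sum]
  refine Finset.sum_congr rfl fun k _ => ?_
  simp only [eval_comp, eval_add, eval_mul, eval_C, eval_X]
  rw [show (v + u) / 2 + (v - u) / 2 * G k = (v + u + (v - u) * G k) / 2 by ring]
  ring

/-- The one-sided Gauss rule estimate transported to an interval `[u, v]`. -/
lemma gauss_quadrature_derivative_mul_le_interval {r : ℕ} (hr : 1 ≤ r) {G A : ℕ → ℝ}
    (hG : IsGaussPoints r G) (hA : IsGaussWeights r G A) (φ F : ℝ[X]) (κ : ℝ) (hκ : 0 ≤ κ)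
    (hφ : φ.natDegree ≤ r) (hF : derivative F = C κ * φ) (u v : ℝ) (huv : u ≤ v) :
    ∑ k ∈ Finset.Icc 1 r,
        (v - u) * A k / 2 * (derivative φ * F).eval ((v + u + (v - u) * G k) / 2) ≤
      ∫ t in u..v, (derivative φ * F).eval t := by
  set L : ℝ[X] := C ((v + u) / 2) + C ((v - u) / 2) * X with hL
  have haff : L.natDegree ≤ 1 := by rw [hL]; compute_degree
  have hdL : derivative L = C ((v - u) / 2) := by simp [hL]
  have hcomp : derivative (φ.comp L) * F.comp L =
      C ((v - u) / 2) * (derivative φ * F).comp L := by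
    rw [derivative_comp, hdL, mul_comp]
    ring
  have hle := gauss_quadrature_derivative_mul_le hr hG hA (φ.comp L) (F.comp L)
    ((v - u) / 2 * κ) (mul_nonneg (by linarith) hκ)
    (natDegree_comp_le.trans ((Nat.mul_le_mul_left _ haff).trans (by omega)))
    (by rw [derivative_comp, hdL, hF, mul_comp, C_comp, C_mul]; ring)
  rw [hcomp, integral_eval_C_mul, integral_eval_comp_affine] at hle
  refine le_trans (le_of_eq (Finset.sum_congr rfl fun k _ => ?_)) hle
  rw [eval_mul (p := C _), eval_C, eval_comp]
  simp only [hL, eval_add, eval_mul, eval_C, eval_X]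
  rw [show (v + u) / 2 + (v - u) / 2 * G k = (v + u + (v - u) * G k) / 2 by ring]
  ring

end GaussQuadrature

section OneDimensional

lemma sum_Icc_sub_eq_of_glue (p q : ℕ → ℝ) (n : ℕ) (hn : 1 ≤ n)
    (h : ∀ j, 1 ≤ j → j < n → p (j + 1) = q j) :
    ∑ j ∈ Finset.Icc 1 n, (q j - p j) = q n - p 1 := by
  induction n, hn using Nat.le_induction with
  | base => simp
  | succ n hn ih =>
    rw [Finset.sum_Icc_succ_top (by omega), ih fun j h1 h2 => h j h1 (by omega),
      h n hn (by omega)]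
    ring

/-- Summation by parts. -/
lemma sum_Icc_mul_sub (W f : ℕ → ℝ) (s : ℕ) :
    ∑ l ∈ Finset.Icc 1 s, W l * (f (l + 1) - f l) =
      W s * f (s + 1) - W 0 * f 1 - ∑ l ∈ Finset.Icc 1 s, (W l - W (l - 1)) * f l := by
  induction s with
  | zero => simp
  | succ s ih =>
    rw [Finset.sum_Icc_succ_top (by omega), Finset.sum_Icc_succ_top (by omega), ih,
      Nat.add_sub_cancel]
    ring

/-- Summation by parts over doubly indexed Gauss nodes. -/
lemma sum_sum_Icc_mul_sub (r : ℕ) (W f : ℕ → ℕ → ℝ) (n : ℕ) (hn : 1 ≤ n)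
    (hW : ∀ j, 1 ≤ j → j < n → W (j + 1) 0 = W j r)
    (hf : ∀ j, 1 ≤ j → j < n → f j (r + 1) = f (j + 1) 1) :
    ∑ j ∈ Finset.Icc 1 n, ∑ l ∈ Finset.Icc 1 r, W j l * (f j (l + 1) - f j l) =
      W n r * f n (r + 1) - W 1 0 * f 1 1 -
        ∑ j ∈ Finset.Icc 1 n, ∑ l ∈ Finset.Icc 1 r, (W j l - W j (l - 1)) * f j l := by
  simp only [sum_Icc_mul_sub, Finset.sum_sub_distrib]
  congr 1
  rw [← Finset.sum_sub_distrib]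
  refine sum_Icc_sub_eq_of_glue (fun j => W j 0 * f j 1) (fun j => W j r * f j (r + 1)) n hn ?_
  intro j h1 h2
  simp only [hW j h1 h2, hf j h1 h2]

lemma exists_derivative_eq (p : ℝ[X]) : ∃ F : ℝ[X], derivative F = p := by
  induction p using Polynomial.induction_on' with
  | add p q hp hq =>
    obtain ⟨F, rfl⟩ := hp
    obtain ⟨H, rfl⟩ := hq
    exact ⟨F + H, derivative_add⟩
  | monomial k c =>
    refine ⟨monomial (k + 1) (c / (k + 1)), ?_⟩
    have : (k : ℝ) + 1 ≠ 0 := by positivity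
    rw [derivative_monomial]
    simp [this]

/-- Piecewise polynomials have continuous piecewise polynomial primitives. -/
lemma exists_glued_primitive (p : ℕ → ℝ[X]) (y : ℕ → ℝ) :
    ∃ F : ℕ → ℝ[X], (∀ j, derivative (F j) = p j) ∧
      ∀ j, (F (j + 1)).eval (y j) = (F j).eval (y j) := by
  choose Q hQ using fun j => exists_derivative_eq (p j)
  let F : ℕ → ℝ[X] := fun j =>
    Nat.rec (Q 0) (fun j Fj => Q (j + 1) + C (Fj.eval (y j) - (Q (j + 1)).eval (y j))) j
  refine ⟨F, fun j => ?_, fun j => ?_⟩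
  · cases j with
    | zero => exact hQ 0
    | succ j => simp [F, hQ]
  · simp [F]

variable {r : ℕ} {G A : ℕ → ℝ}

/-- If the increments of `W` are weighted values of `φ'` at all Gauss nodes but the last one,
they are so at the last node as well. -/
lemma increment_eq_of_forall_ne_last (hr : 1 ≤ r) (hG : IsGaussPoints r G)
    (hA : IsGaussWeights r G A) (n : ℕ) (hn : 1 ≤ n) (y : ℕ → ℝ) (φ : ℕ → ℝ[X])
    (hφdeg : ∀ j, 1 ≤ j → j ≤ n → (φ j).natDegree ≤ r)
    (hφglue : ∀ j, 1 ≤ j → j < n → (φ (j + 1)).eval (y j) = (φ j).eval (y j))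
    (hφ0 : (φ 1).eval (y 0) = 0) (hφn : (φ n).eval (y n) = 0)
    (W : ℕ → ℕ → ℝ) (hW0 : W 1 0 = 0) (hWn : W n r = 0)
    (hWglue : ∀ j, 1 ≤ j → j < n → W (j + 1) 0 = W j r) (K : ℝ)
    (hjump : ∀ j, 1 ≤ j → j ≤ n → ∀ l, 1 ≤ l → l ≤ r → ¬(j = n ∧ l = r) →
      W j l - W j (l - 1) = K * ((y j - y (j - 1)) * A l / 2 *
        (derivative (φ j)).eval ((y j + y (j - 1) + (y j - y (j - 1)) * G l) / 2)))
    (j : ℕ) (hj1 : 1 ≤ j) (hj2 : j ≤ n) (l : ℕ) (hl1 : 1 ≤ l) (hl2 : l ≤ r) :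
    W j l - W j (l - 1) = K * ((y j - y (j - 1)) * A l / 2 *
        (derivative (φ j)).eval ((y j + y (j - 1) + (y j - y (j - 1)) * G l) / 2)) := by
  by_cases hjl : ¬(j = n ∧ l = r)
  · exact hjump j hj1 hj2 l hl1 hl2 hjl
  push Not at hjl
  obtain ⟨rfl, rfl⟩ := hjl
  set R : ℕ → ℕ → ℝ := fun i k => K * ((y i - y (i - 1)) * A k / 2 *
        (derivative (φ i)).eval ((y i + y (i - 1) + (y i - y (i - 1)) * G k) / 2)) with hR
  have hsumW : ∑ i ∈ Finset.Icc 1 j, ∑ k ∈ Finset.Icc 1 l, (W i k - W i (k - 1)) = 0 := by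
    have h := sum_sum_Icc_mul_sub l W (fun _ _ => 1) j hn hWglue (fun _ _ _ => rfl)
    simp only [hWn, hW0, sub_self, mul_zero, mul_one, Finset.sum_const_zero] at h
    linarith
  have hsumR : ∑ i ∈ Finset.Icc 1 j, ∑ k ∈ Finset.Icc 1 l, R i k = 0 := by
    have hi : ∀ i ∈ Finset.Icc 1 j, ∑ k ∈ Finset.Icc 1 l, R i k =
        K * ((φ i).eval (y i) - (φ i).eval (y (i - 1))) := by
      intro i hi
      rw [Finset.mem_Icc] at hi
      have hd := (natDegree_derivative_le (φ i)).trans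
        (Nat.sub_le_sub_right (hφdeg i hi.1 hi.2) 1)
      rw [hR, ← Finset.mul_sum, gauss_quadrature_exact_interval hG hA _ (by omega),
        integral_eval_derivative]
    rw [Finset.sum_congr rfl hi, ← Finset.mul_sum,
      sum_Icc_sub_eq_of_glue (fun i => (φ i).eval (y (i - 1))) (fun i => (φ i).eval (y i)) j hn
        (by simpa using hφglue)]
    simp [hφ0, hφn]
  have hdiff : ∑ i ∈ Finset.Icc 1 j, ∑ k ∈ Finset.Icc 1 l,
      (W i k - W i (k - 1) - R i k) = 0 := by
    rw [← sub_self (0 : ℝ)]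
    nth_rewrite 1 [← hsumW]
    rw [← hsumR]
    simp only [Finset.sum_sub_distrib]
  rw [Finset.sum_eq_single j, Finset.sum_eq_single l] at hdiff
  · exact sub_eq_zero.mp hdiff
  · intro k hk hkl
    rw [Finset.mem_Icc] at hk
    exact sub_eq_zero.mpr (hjump j hj1 hj2 k hk.1 hk.2 (by omega))
  · exact fun h => absurd (Finset.mem_Icc.mpr ⟨hl1, hl2⟩) h
  · intro i hi hij
    rw [Finset.mem_Icc] at hi
    refine Finset.sum_eq_zero fun k hk => ?_
    rw [Finset.mem_Icc] at hk
    exact sub_eq_zero.mpr (hjump i hi.1 hi.2 k hk.1 hk.2 (by omega))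
  · exact fun h => absurd (Finset.mem_Icc.mpr ⟨hj1, hj2⟩) h

/-- One-dimensional coercivity along a Gauss line. -/
lemma one_dim_coercivity (hr : 1 ≤ r) (hG : IsGaussPoints r G)
    (hA : IsGaussWeights r G A) (n : ℕ) (hn : 1 ≤ n) (y : ℕ → ℝ)
    (hy : ∀ j, 1 ≤ j → j ≤ n → y (j - 1) ≤ y j) (φ F : ℕ → ℝ[X]) (κ : ℕ → ℝ)
    (hκ : ∀ j, 1 ≤ j → j ≤ n → 0 ≤ κ j)
    (hφdeg : ∀ j, 1 ≤ j → j ≤ n → (φ j).natDegree ≤ r)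
    (hφglue : ∀ j, 1 ≤ j → j < n → (φ (j + 1)).eval (y j) = (φ j).eval (y j))
    (hφ0 : (φ 1).eval (y 0) = 0) (hφn : (φ n).eval (y n) = 0)
    (hF : ∀ j, derivative (F j) = C (κ j) * φ j)
    (hFglue : ∀ j, (F (j + 1)).eval (y j) = (F j).eval (y j))
    (W : ℕ → ℕ → ℝ) (hW0 : W 1 0 = 0) (hWn : W n r = 0)
    (hWglue : ∀ j, 1 ≤ j → j < n → W (j + 1) 0 = W j r) (K : ℝ) (hK : 0 ≤ K)
    (hjump : ∀ j, 1 ≤ j → j ≤ n → ∀ l, 1 ≤ l → l ≤ r → ¬(j = n ∧ l = r) →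
      W j l - W j (l - 1) = K * ((y j - y (j - 1)) * A l / 2 *
        (derivative (φ j)).eval ((y j + y (j - 1) + (y j - y (j - 1)) * G l) / 2)))
    (E : ℕ → ℕ → ℝ)
    (hE : ∀ j, 1 ≤ j → j ≤ n → ∀ l, 1 ≤ l → l < r →
      E j l = (F j).eval ((y j + y (j - 1) + (y j - y (j - 1)) * G (l + 1)) / 2) -
        (F j).eval ((y j + y (j - 1) + (y j - y (j - 1)) * G l) / 2))
    (hEr : ∀ j, 1 ≤ j → j < n →
      E j r = (F (j + 1)).eval ((y (j + 1) + y j + (y (j + 1) - y j) * G 1) / 2) -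
        (F j).eval ((y j + y (j - 1) + (y j - y (j - 1)) * G r) / 2)) :
    K * ∑ j ∈ Finset.Icc 1 n, κ j * ∫ t in (y (j - 1))..(y j), ((φ j).eval t) ^ 2 ≤
      ∑ j ∈ Finset.Icc 1 n, ∑ l ∈ Finset.Icc 1 r, W j l * E j l := by
  set g : ℕ → ℕ → ℝ := fun j l => (y j + y (j - 1) + (y j - y (j - 1)) * G l) / 2 with hg
  set f : ℕ → ℕ → ℝ := fun j l =>
    if l = r + 1 then (F (j + 1)).eval (g (j + 1) 1) else (F j).eval (g j l) with hf
  have hfE : ∑ j ∈ Finset.Icc 1 n, ∑ l ∈ Finset.Icc 1 r, W j l * E j l =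
      ∑ j ∈ Finset.Icc 1 n, ∑ l ∈ Finset.Icc 1 r, W j l * (f j (l + 1) - f j l) := by
    refine Finset.sum_congr rfl fun j hj => Finset.sum_congr rfl fun l hl => ?_
    rw [Finset.mem_Icc] at hj hl
    by_cases hlr : l < r
    · rw [hE j hj.1 hj.2 l hl.1 hlr]
      simp [hf, hg, hlr.ne, show l ≠ r + 1 by omega]
    · obtain rfl : l = r := by omega
      by_cases hjn : j < n
      · rw [hEr j hj.1 hjn]
        simp [hf, hg]
      · obtain rfl : j = n := by omega
        simp [hWn]
  have hparts := sum_sum_Icc_mul_sub r W f n hn hWglue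
    (fun j _ _ => by simp [hf, show r ≠ 0 by omega])
  rw [hWn, hW0, zero_mul, zero_mul, sub_zero, zero_sub] at hparts
  have hinc := increment_eq_of_forall_ne_last hr hG hA n hn y φ hφdeg hφglue hφ0 hφn W hW0 hWn
    hWglue K hjump
  have hle : ∑ j ∈ Finset.Icc 1 n, ∑ l ∈ Finset.Icc 1 r, (W j l - W j (l - 1)) * f j l ≤
      ∑ j ∈ Finset.Icc 1 n, K * (((φ j).eval (y j) * (F j).eval (y j) -
        (φ j).eval (y (j - 1)) * (F j).eval (y (j - 1))) -
          κ j * ∫ t in (y (j - 1))..(y j), ((φ j).eval t) ^ 2) := by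
    refine Finset.sum_le_sum fun j hj => ?_
    rw [Finset.mem_Icc] at hj
    have hq := gauss_quadrature_derivative_mul_le_interval hr hG hA (φ j) (F j) (κ j)
      (hκ j hj.1 hj.2) (hφdeg j hj.1 hj.2) (hF j) (y (j - 1)) (y j) (hy j hj.1 hj.2)
    have hint : ∫ t in (y (j - 1))..(y j), (φ j * derivative (F j)).eval t =
        κ j * ∫ t in (y (j - 1))..(y j), ((φ j).eval t) ^ 2 := by
      rw [hF, ← intervalIntegral.integral_const_mul]
      refine intervalIntegral.integral_congr fun t _ => ?_
      simp only [eval_mul, eval_C]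
      ring
    rw [integral_eval_mul_derivative, hint] at hq
    refine le_trans (le_of_eq ?_) (mul_le_mul_of_nonneg_left hq hK)
    rw [Finset.mul_sum]
    refine Finset.sum_congr rfl fun l hl => ?_
    rw [Finset.mem_Icc] at hl
    rw [hinc j hj.1 hj.2 l hl.1 hl.2]
    simp only [hf, hg, show l ≠ r + 1 by omega, if_false, eval_mul]
    ring
  have htel : ∑ j ∈ Finset.Icc 1 n, ((φ j).eval (y j) * (F j).eval (y j) -
        (φ j).eval (y (j - 1)) * (F j).eval (y (j - 1))) = 0 := by
    rw [sum_Icc_sub_eq_of_glue (fun j => (φ j).eval (y (j - 1)) * (F j).eval (y (j - 1)))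
      (fun j => (φ j).eval (y j) * (F j).eval (y j)) n hn]
    · simp [hφ0, hφn]
    · intro j h1 h2
      simp [hφglue j h1 h2, hFglue j]
  rw [← Finset.mul_sum, Finset.sum_sub_distrib, htel] at hle
  rw [hfE, hparts]
  linarith

end OneDimensional

section BivariatePolynomials

lemma hasDerivAt_fst_slice {f : ℝ × ℝ → ℝ} {x y : ℝ} (hf : DifferentiableAt ℝ f (x, y)) :
    HasDerivAt (fun s => f (s, y)) (pdx f (x, y)) x :=
  hf.hasFDerivAt.comp_hasDerivAt x ((hasDerivAt_id x).prodMk (hasDerivAt_const x y))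

lemma hasDerivAt_snd_slice {f : ℝ × ℝ → ℝ} {x y : ℝ} (hf : DifferentiableAt ℝ f (x, y)) :
    HasDerivAt (fun t => f (x, t)) (pdy f (x, y)) y :=
  hf.hasFDerivAt.comp_hasDerivAt y ((hasDerivAt_const y x).prodMk (hasDerivAt_id y))

lemma pdx_eq_of_eqOn_slice {f g : ℝ × ℝ → ℝ} (hf : Differentiable ℝ f) (hg : Differentiable ℝ g)
    {u v y : ℝ} (h : ∀ s ∈ Set.Ioo u v, f (s, y) = g (s, y)) {x : ℝ} (hx : x ∈ Set.Ioo u v) :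
    pdx f (x, y) = pdx g (x, y) := by
  have h1 := hasDerivAt_fst_slice (hf (x, y))
  have h2 := hasDerivAt_fst_slice (hg (x, y))
  refine (h1.congr_of_eventuallyEq ?_).unique h2
  filter_upwards [isOpen_Ioo.mem_nhds hx] with s hs using (h s hs).symm

lemma fderiv_comp_swap (f : ℝ × ℝ → ℝ) (z : ℝ × ℝ) :
    fderiv ℝ (fun z : ℝ × ℝ => f z.swap) z =
      (fderiv ℝ f z.swap).comp (ContinuousLinearEquiv.prodComm ℝ ℝ ℝ : ℝ × ℝ →L[ℝ] ℝ × ℝ) :=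
  (ContinuousLinearEquiv.prodComm ℝ ℝ ℝ).comp_right_fderiv (f := f) (x := z)

lemma pdx_comp_swap (f : ℝ × ℝ → ℝ) (z : ℝ × ℝ) :
    pdx (fun z => f z.swap) z = pdy f z.swap := by
  rw [pdx, pdy, fderiv_comp_swap]
  rfl

lemma pdy_comp_swap (f : ℝ × ℝ → ℝ) (z : ℝ × ℝ) :
    pdy (fun z => f z.swap) z = pdx f z.swap := by
  rw [pdx, pdy, fderiv_comp_swap]
  rfl

lemma pdy_pdx_comm {f : ℝ × ℝ → ℝ} (hf : ContDiff ℝ 2 f) (z : ℝ × ℝ) :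
    pdy (pdx f) z = pdx (pdy f) z := by
  have hd : Differentiable ℝ (fderiv ℝ f) :=
    (hf.fderiv_right (m := 1) (by norm_num)).differentiable (by norm_num)
  have hsymm : IsSymmSndFDerivAt ℝ f z := hf.contDiffAt.isSymmSndFDerivAt (by simp)
  have h : ∀ u : ℝ × ℝ, fderiv ℝ (fun z => fderiv ℝ f z u) z =
      (fderiv ℝ (fderiv ℝ f) z).flip u := by
    intro u
    rw [fderiv_clm_apply (hd z) (differentiableAt_const u)]
    simp
  unfold pdx pdy
  rw [h, h]
  exact hsymm.eq _ _

lemma contDiff_pdx {f : ℝ × ℝ → ℝ} (hf : ContDiff ℝ 2 f) : ContDiff ℝ 1 (pdx f) :=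
  (hf.fderiv_right (m := 1) (by norm_num)).clm_apply contDiff_const

lemma evalXY_eq (p : ℝ[X][X]) (x y : ℝ) : evalXY p x y = (p.eval (C x)).eval y := by
  rw [evalXY, map_evalRingHom_eval]

lemma IsBiPoly.exists_coeff {r : ℕ} {f : ℝ × ℝ → ℝ} (hf : IsBiPoly r f) :
    ∃ c : ℕ → ℕ → ℝ, ∀ z : ℝ × ℝ, f z =
      ∑ k ∈ Finset.range (r + 1), ∑ l ∈ Finset.range (r + 1), c k l * z.1 ^ k * z.2 ^ l := by
  obtain ⟨p, hp, hpc, hfp⟩ := hf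
  refine ⟨fun k l => (p.coeff k).coeff l, fun ⟨x, y⟩ => ?_⟩
  rw [hfp, evalXY, eval_eq_sum_range' (n := r + 1)
    (lt_of_le_of_lt (natDegree_map_le) (by omega))]
  refine Finset.sum_congr rfl fun k _ => ?_
  rw [coeff_map, coe_evalRingHom, eval_eq_sum_range' (n := r + 1)
    (lt_of_le_of_lt (hpc k) (by omega)), Finset.sum_mul]
  refine Finset.sum_congr rfl fun l _ => ?_
  ring

lemma IsBiPoly.of_coeff {r : ℕ} {f : ℝ × ℝ → ℝ} (c : ℕ → ℕ → ℝ) (hf : ∀ z : ℝ × ℝ, f z =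
      ∑ k ∈ Finset.range (r + 1), ∑ l ∈ Finset.range (r + 1), c k l * z.1 ^ k * z.2 ^ l) :
    IsBiPoly r f := by
  refine ⟨∑ k ∈ Finset.range (r + 1), monomial k (∑ l ∈ Finset.range (r + 1),
    monomial l (c k l)), ?_, fun i => ?_, fun x y => ?_⟩
  · refine natDegree_sum_le_of_forall_le _ _ fun k hk => (natDegree_monomial_le _).trans ?_
    rw [Finset.mem_range] at hk
    omega
  · rw [finsetSum_coeff]
    refine natDegree_sum_le_of_forall_le _ _ fun k _ => ?_
    rw [coeff_monomial]
    split_ifs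
    · refine natDegree_sum_le_of_forall_le _ _ fun l hl => (natDegree_monomial_le _).trans ?_
      rw [Finset.mem_range] at hl
      omega
    · simp
  · rw [hf, evalXY_eq]
    simp only [eval_finsetSum, eval_monomial, eval_mul, eval_pow, eval_C, Finset.sum_mul]
    exact Finset.sum_congr rfl fun k _ => Finset.sum_congr rfl fun l _ => by ring

lemma IsBiPoly.swap {r : ℕ} {f : ℝ × ℝ → ℝ} (hf : IsBiPoly r f) :
    IsBiPoly r (fun z => f z.swap) := by
  obtain ⟨c, hc⟩ := hf.exists_coeff
  refine IsBiPoly.of_coeff (fun k l => c l k) fun z => ?_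
  rw [hc, Finset.sum_comm]
  exact Finset.sum_congr rfl fun k _ => Finset.sum_congr rfl fun l _ => by
    simp only [Prod.fst_swap, Prod.snd_swap]
    ring

lemma IsBiPoly.contDiff {r : ℕ} {f : ℝ × ℝ → ℝ} (hf : IsBiPoly r f) : ContDiff ℝ 2 f := by
  obtain ⟨c, hc⟩ := hf.exists_coeff
  rw [funext hc]
  fun_prop

lemma IsBiPoly.differentiable {r : ℕ} {f : ℝ × ℝ → ℝ} (hf : IsBiPoly r f) :
    Differentiable ℝ f :=
  hf.contDiff.differentiable (by norm_num)

lemma IsBiPoly.exists_pdx_fst_slice {r : ℕ} {f : ℝ × ℝ → ℝ} (hf : IsBiPoly r f) (y : ℝ) :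
    ∃ ψ : ℝ[X], ψ.natDegree ≤ r - 1 ∧ ∀ x, pdx f (x, y) = ψ.eval x := by
  have hdiff := hf.differentiable
  obtain ⟨p, hp, -, hfp⟩ := hf
  refine ⟨derivative (p.map (evalRingHom y)),
    (natDegree_derivative_le _).trans (Nat.sub_le_sub_right (natDegree_map_le.trans hp) 1),
    fun x => ?_⟩
  have h := hasDerivAt_fst_slice (hdiff (x, y))
  simp only [hfp] at h
  exact h.unique ((p.map (evalRingHom y)).hasDerivAt x)

lemma IsBiPoly.exists_pdx_snd_slice {r : ℕ} {f : ℝ × ℝ → ℝ} (hf : IsBiPoly r f) (x : ℝ) :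
    ∃ φ : ℝ[X], φ.natDegree ≤ r ∧ (∀ y, pdx f (x, y) = φ.eval y) ∧
      ∀ y, pdy (pdx f) (x, y) = (derivative φ).eval y := by
  have hcont := hf.contDiff
  have hdiff := hf.differentiable
  obtain ⟨p, hp, hpc, hfp⟩ := hf
  have hφ : ∀ y, pdx f (x, y) = ((derivative p).eval (C x)).eval y := by
    intro y
    have h := hasDerivAt_fst_slice (hdiff (x, y))
    simp only [hfp] at h
    rw [← evalXY_eq, evalXY, ← derivative_map]
    exact h.unique ((p.map (evalRingHom y)).hasDerivAt x)
  refine ⟨(derivative p).eval (C x), ?_, hφ, fun y => ?_⟩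
  · rw [eval_eq_sum_range]
    refine natDegree_sum_le_of_forall_le _ _ fun k _ => ?_
    rw [← C_pow]
    refine (natDegree_mul_C_le _ _).trans ?_
    rw [coeff_derivative]
    have : ((k : ℝ[X]) + 1) = C ((k : ℝ) + 1) := by simp
    rw [this]
    exact (natDegree_mul_C_le _ _).trans (hpc _)
  · have h := hasDerivAt_snd_slice ((contDiff_pdx hcont).differentiable (by norm_num) (x, y))
    simp only [hφ] at h
    exact h.unique (Polynomial.hasDerivAt _ y)

end BivariatePolynomials

section Swap

variable {a b c d : ℝ}

/-- The partition with the two coordinates exchanged. -/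
def RectPartition.swap (P : RectPartition a b c d) : RectPartition c d a b where
  m := P.n
  n := P.m
  hm := P.hn
  hn := P.hm
  x := P.y
  y := P.x
  hxa := P.hyc
  hxb := P.hyd
  hyc := P.hxa
  hyd := P.hxb
  hxlt := P.hylt
  hylt := P.hxlt

/-- The piecewise function with the two coordinates exchanged. -/
def PiecewiseFun.swap {P : RectPartition a b c d} (v : PiecewiseFun P) :
    PiecewiseFun P.swap where
  toFun := fun z => v.toFun z.swap
  cellFun := fun j i z => v.cellFun i j z.swap
  agree := fun j hj i hi z hz => v.agree i hi j hj z.swap ⟨hz.2, hz.1⟩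

lemma IsTrialFun.swap {r : ℕ} {P : RectPartition a b c d} {v : PiecewiseFun P}
    (hv : IsTrialFun r P v) : IsTrialFun r P.swap v.swap := by
  refine ⟨?_, ?_, fun j hj i hi => (hv.2.2 i hi j hj).swap⟩
  · exact hv.1.comp continuous_swap.continuousOn fun z hz => ⟨hz.2, hz.1⟩
  · intro z hz
    exact hv.2.1 z.swap ⟨⟨hz.1.2, hz.1.1⟩, fun h => hz.2 ⟨h.2, h.1⟩⟩

lemma wE_swap (r : ℕ) (w : ℕ → ℕ → ℕ → ℕ → ℝ) (i k j l : ℕ) :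
    wE r (fun j l i k => w i k j l) j l i k = wE r w i k j l := by
  unfold wE
  simp only [or_comm]

lemma jumpX_swap (r : ℕ) (w : ℕ → ℕ → ℕ → ℕ → ℝ) (i k j l : ℕ) :
    jumpX r (fun j l i k => w i k j l) j l i k = jumpY r w i k j l := by
  simp only [jumpX, jumpY, wE_swap]

lemma jumpXY_swap (r : ℕ) (w : ℕ → ℕ → ℕ → ℕ → ℝ) (i k j l : ℕ) :
    jumpXY r (fun j l i k => w i k j l) j l i k = jumpXY r w i k j l := by
  simp only [jumpXY, wE_swap]
  ring

lemma IsTestFun.swap {r : ℕ} {P : RectPartition a b c d} {w : ℕ → ℕ → ℕ → ℕ → ℝ}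
    (hw : IsTestFun r P w) : IsTestFun r P.swap (fun j l i k => w i k j l) :=
  ⟨hw.2, hw.1⟩

lemma IsPiOf.swap {r : ℕ} {G A : ℕ → ℝ} {P : RectPartition a b c d} {v : PiecewiseFun P}
    (hv : IsTrialFun r P v) {w : ℕ → ℕ → ℕ → ℕ → ℝ} (hw : IsPiOf r G A P v w) :
    IsPiOf r G A P.swap v.swap (fun j l i k => w i k j l) := by
  refine ⟨hw.1.swap, fun j hj l hl i hi k hk h1 h2 => ?_⟩
  have hb := hv.2.2 i hi j hj
  have hx : pdx (v.swap.cellFun j i) = fun z => pdy (v.cellFun i j) z.swap :=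
    funext fun z => pdx_comp_swap (v.cellFun i j) z
  rw [jumpXY_swap, hw.2 i hi k hk j hj l hl h2 h1, hx, pdy_comp_swap,
    pdy_pdx_comm hb.contDiff]
  change _ = (P.hy j * A l / 2) * (P.hx i * A k / 2) *
    pdx (pdy (v.cellFun i j)) (P.gx r G i k, P.gy r G j l)
  ring

lemma PiecewiseConstant.swap {P : RectPartition a b c d} {α : ℝ × ℝ → ℝ}
    (h : PiecewiseConstant P α) : PiecewiseConstant P.swap (fun z => α z.swap) := by
  intro j hj i hi
  obtain ⟨cst, hc⟩ := h i hi j hj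
  exact ⟨cst, fun z hz => hc z.swap ⟨hz.2, hz.1⟩⟩

end Swap

section Geometry

variable {a b c d : ℝ} (P : RectPartition a b c d)

lemma RectPartition.x_mono {i j : ℕ} (hij : i ≤ j) (hj : j ≤ P.m) : P.x i ≤ P.x j := by
  induction j, hij using Nat.le_induction with
  | base => exact le_rfl
  | succ j hij ih => exact (ih (by omega)).trans (P.hxlt j (by omega)).le

lemma RectPartition.y_mono {i j : ℕ} (hij : i ≤ j) (hj : j ≤ P.n) : P.y i ≤ P.y j :=
  P.swap.x_mono hij hj

lemma RectPartition.y_pred_lt {j : ℕ} (h1 : 1 ≤ j) (h2 : j ≤ P.n) : P.y (j - 1) < P.y j := by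
  have := P.hylt (j - 1) (by omega)
  rwa [Nat.sub_add_cancel h1] at this

lemma RectPartition.x_pred_lt {i : ℕ} (h1 : 1 ≤ i) (h2 : i ≤ P.m) : P.x (i - 1) < P.x i :=
  P.swap.y_pred_lt h1 h2

lemma RectPartition.cell_subset_dom {i j : ℕ} (hi : i ≤ P.m) (hj : j ≤ P.n) :
    P.cell i j ⊆ P.dom := by
  rintro ⟨s, t⟩ ⟨hs, ht⟩
  refine ⟨⟨?_, ?_⟩, ⟨?_, ?_⟩⟩
  · rw [← P.hxa]; exact (P.x_mono (Nat.zero_le _) (by omega)).trans hs.1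
  · rw [← P.hxb]; exact hs.2.trans (P.x_mono hi le_rfl)
  · rw [← P.hyc]; exact (P.y_mono (Nat.zero_le _) (by omega)).trans ht.1
  · rw [← P.hyd]; exact ht.2.trans (P.y_mono hj le_rfl)

lemma gauss_node_mem_Ioo {u v g : ℝ} (huv : u < v) (hg : g ∈ Set.Ioo (-1 : ℝ) 1) :
    (v + u + (v - u) * g) / 2 ∈ Set.Ioo u v := by
  obtain ⟨h1, h2⟩ := hg
  constructor <;> nlinarith

lemma RectPartition.gy_of_le {r : ℕ} (G : ℕ → ℝ) (j : ℕ) {l : ℕ} (hl : l ≤ r) :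
    P.gy r G j l = (P.y j + P.y (j - 1) + (P.y j - P.y (j - 1)) * G l) / 2 := by
  rw [RectPartition.gy, if_neg (by omega), RectPartition.hy]

lemma RectPartition.gx_of_le {r : ℕ} (G : ℕ → ℝ) (i : ℕ) {k : ℕ} (hk : k ≤ r) :
    P.gx r G i k = (P.x i + P.x (i - 1) + (P.x i - P.x (i - 1)) * G k) / 2 :=
  P.swap.gy_of_le G i hk

lemma RectPartition.gy_succ {r : ℕ} (G : ℕ → ℝ) {j : ℕ} (hj : j < P.n) :
    P.gy r G j (r + 1) =
      (P.y (j + 1) + P.y j + (P.y (j + 1) - P.y j) * G 1) / 2 := by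
  rw [RectPartition.gy, if_pos rfl, if_neg (by omega), RectPartition.hy, Nat.add_sub_cancel]

lemma RectPartition.gy_mem {r : ℕ} {G : ℕ → ℝ} (hG : IsGaussPoints r G) {j l : ℕ}
    (hj1 : 1 ≤ j) (hj2 : j ≤ P.n) (hl1 : 1 ≤ l) (hl2 : l ≤ r) :
    P.gy r G j l ∈ Set.Ioo (P.y (j - 1)) (P.y j) := by
  rw [P.gy_of_le G j hl2]
  exact gauss_node_mem_Ioo (P.y_pred_lt hj1 hj2) (hG.2 l hl1 hl2).1

lemma RectPartition.gx_mem {r : ℕ} {G : ℕ → ℝ} (hG : IsGaussPoints r G) {i k : ℕ}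
    (hi1 : 1 ≤ i) (hi2 : i ≤ P.m) (hk1 : 1 ≤ k) (hk2 : k ≤ r) :
    P.gx r G i k ∈ Set.Ioo (P.x (i - 1)) (P.x i) :=
  P.swap.gy_mem hG hi1 hi2 hk1 hk2

end Geometry

section TrialFunctions

variable {a b c d : ℝ} {P : RectPartition a b c d} {v : PiecewiseFun P} {r : ℕ}

lemma IsTrialFun.pdx_glue (hv : IsTrialFun r P v) {i j : ℕ} (hi1 : 1 ≤ i) (hi2 : i ≤ P.m)
    (hj1 : 1 ≤ j) (hj2 : j < P.n) {x : ℝ} (hx : x ∈ Set.Ioo (P.x (i - 1)) (P.x i)) :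
    pdx (v.cellFun i (j + 1)) (x, P.y j) = pdx (v.cellFun i j) (x, P.y j) := by
  have hi := Finset.mem_Icc.mpr ⟨hi1, hi2⟩
  have hj := Finset.mem_Icc.mpr ⟨hj1, hj2.le⟩
  have hj' : j + 1 ∈ Finset.Icc 1 P.n := Finset.mem_Icc.mpr ⟨by omega, by omega⟩
  refine pdx_eq_of_eqOn_slice (hv.2.2 i hi _ hj').differentiable
    (hv.2.2 i hi _ hj).differentiable (fun s hs => ?_) hx
  rw [v.agree i hi _ hj' (s, P.y j), v.agree i hi _ hj (s, P.y j)]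
  · exact ⟨⟨hs.1.le, hs.2.le⟩, (P.y_pred_lt hj1 hj2.le).le, le_rfl⟩
  · exact ⟨⟨hs.1.le, hs.2.le⟩, le_rfl, (P.hylt j hj2).le⟩

lemma IsTrialFun.pdx_eq_zero (hv : IsTrialFun r P v) {i j : ℕ} (hi1 : 1 ≤ i) (hi2 : i ≤ P.m)
    (hj1 : 1 ≤ j) (hj2 : j ≤ P.n) {x y : ℝ} (hx : x ∈ Set.Ioo (P.x (i - 1)) (P.x i))
    (hy : y ∈ Set.Icc (P.y (j - 1)) (P.y j)) (hbd : y = c ∨ y = d) :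
    pdx (v.cellFun i j) (x, y) = 0 := by
  have hi := Finset.mem_Icc.mpr ⟨hi1, hi2⟩
  have hj := Finset.mem_Icc.mpr ⟨hj1, hj2⟩
  have h := pdx_eq_of_eqOn_slice (hv.2.2 i hi _ hj).differentiable
    (differentiable_const (0 : ℝ)) (y := y) (fun s hs => ?_) hx
  · rw [h]
    simp [pdx]
  · have hcell : (s, y) ∈ P.cell i j := ⟨⟨hs.1.le, hs.2.le⟩, hy⟩
    rw [v.agree i hi _ hj (s, y) hcell]
    refine hv.2.1 _ ⟨P.cell_subset_dom hi2 hj2 hcell, fun hmem => ?_⟩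
    rcases hbd with rfl | rfl
    · exact lt_irrefl _ hmem.2.1
    · exact lt_irrefl _ hmem.2.2

lemma IsTrialFun.pdx_bot (hv : IsTrialFun r P v) {i : ℕ} (hi1 : 1 ≤ i) (hi2 : i ≤ P.m)
    {x : ℝ} (hx : x ∈ Set.Ioo (P.x (i - 1)) (P.x i)) :
    pdx (v.cellFun i 1) (x, P.y 0) = 0 :=
  hv.pdx_eq_zero hi1 hi2 le_rfl P.hn hx ⟨le_rfl, (P.hylt 0 P.hn).le⟩ (Or.inl P.hyc)

lemma IsTrialFun.pdx_top (hv : IsTrialFun r P v) {i : ℕ} (hi1 : 1 ≤ i) (hi2 : i ≤ P.m)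
    {x : ℝ} (hx : x ∈ Set.Ioo (P.x (i - 1)) (P.x i)) :
    pdx (v.cellFun i P.n) (x, P.y P.n) = 0 :=
  hv.pdx_eq_zero hi1 hi2 P.hn le_rfl hx ⟨(P.y_pred_lt P.hn le_rfl).le, le_rfl⟩ (Or.inr P.hyd)

end TrialFunctions

section TestFunctions

variable {a b c d : ℝ} {P : RectPartition a b c d} {r : ℕ} {w : ℕ → ℕ → ℕ → ℕ → ℝ}

lemma wE_snd_zero (r : ℕ) (w : ℕ → ℕ → ℕ → ℕ → ℝ) (i k : ℕ) : wE r w i k 1 0 = 0 := by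
  simp [wE]

lemma wE_snd_glue (hr : 1 ≤ r) (w : ℕ → ℕ → ℕ → ℕ → ℝ) (i k : ℕ) {j : ℕ} (hj : 1 ≤ j) :
    wE r w i k (j + 1) 0 = wE r w i k j r := by
  simp [wE, show j ≠ 0 by omega, show r ≠ 0 by omega]

lemma IsTestFun.wE_snd_last (hw : IsTestFun r P w) (hr : 1 ≤ r) {i k : ℕ} (hi1 : 1 ≤ i)
    (hi2 : i ≤ P.m) (hk : k ≤ r) : wE r w i k P.n r = 0 := by
  unfold wE
  split_ifs with h1 h2 h3 h3
  · rfl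
  · omega
  · exact hw.2 _ (Finset.mem_Icc.mpr (by omega)) _ (Finset.mem_Icc.mpr (by omega))
  · omega
  · exact hw.2 _ (Finset.mem_Icc.mpr (by omega)) _ (Finset.mem_Icc.mpr (by omega))

lemma jumpX_snd_zero (r : ℕ) (w : ℕ → ℕ → ℕ → ℕ → ℝ) (i k : ℕ) : jumpX r w i k 1 0 = 0 := by
  simp [jumpX, wE_snd_zero]

lemma jumpX_snd_glue (hr : 1 ≤ r) (w : ℕ → ℕ → ℕ → ℕ → ℝ) (i k : ℕ) {j : ℕ} (hj : 1 ≤ j) :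
    jumpX r w i k (j + 1) 0 = jumpX r w i k j r := by
  simp [jumpX, wE_snd_glue hr w _ _ hj]

lemma IsTestFun.jumpX_snd_last (hw : IsTestFun r P w) (hr : 1 ≤ r) {i k : ℕ} (hi1 : 1 ≤ i)
    (hi2 : i ≤ P.m) (hk : k ≤ r) : jumpX r w i k P.n r = 0 := by
  rw [jumpX, hw.wE_snd_last hr hi1 hi2 hk, hw.wE_snd_last hr hi1 hi2 (by omega), sub_zero]

lemma jumpX_sub_jumpX (r : ℕ) (w : ℕ → ℕ → ℕ → ℕ → ℝ) (i k j l : ℕ) :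
    jumpX r w i k j l - jumpX r w i k j (l - 1) = jumpXY r w i k j l := by
  simp only [jumpX, jumpXY]
  ring

end TestFunctions

section Coercivity

variable {a b c d : ℝ} {P : RectPartition a b c d} {v : PiecewiseFun P} {r : ℕ}
  {G A : ℕ → ℝ} {w : ℕ → ℕ → ℕ → ℕ → ℝ}

/-- Along the vertical Gauss line `x ∈ (x_{i-1}, x_i)`, the derivative `∂v/∂x` is represented
by polynomials of degree at most `r` glued continuously and vanishing at both ends. -/
lemma IsTrialFun.exists_slice (hv : IsTrialFun r P v) {i : ℕ} (hi1 : 1 ≤ i) (hi2 : i ≤ P.m)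
    {x : ℝ} (hx : x ∈ Set.Ioo (P.x (i - 1)) (P.x i)) :
    ∃ φ : ℕ → ℝ[X],
      (∀ j, 1 ≤ j → j ≤ P.n → (φ j).natDegree ≤ r) ∧
      (∀ j, 1 ≤ j → j ≤ P.n → ∀ y, pdx (v.cellFun i j) (x, y) = (φ j).eval y) ∧
      (∀ j, 1 ≤ j → j ≤ P.n → ∀ y,
        pdy (pdx (v.cellFun i j)) (x, y) = (derivative (φ j)).eval y) ∧
      (∀ j, 1 ≤ j → j < P.n → (φ (j + 1)).eval (P.y j) = (φ j).eval (P.y j)) ∧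
      (φ 1).eval (P.y 0) = 0 ∧ (φ P.n).eval (P.y P.n) = 0 := by
  have hex : ∀ j, ∃ φ : ℝ[X], 1 ≤ j → j ≤ P.n → φ.natDegree ≤ r ∧
      (∀ y, pdx (v.cellFun i j) (x, y) = φ.eval y) ∧
      ∀ y, pdy (pdx (v.cellFun i j)) (x, y) = (derivative φ).eval y := by
    intro j
    by_cases hj : 1 ≤ j ∧ j ≤ P.n
    · obtain ⟨φ, hφ⟩ := (hv.2.2 i (Finset.mem_Icc.mpr ⟨hi1, hi2⟩) j
        (Finset.mem_Icc.mpr hj)).exists_pdx_snd_slice x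
      exact ⟨φ, fun _ _ => hφ⟩
    · exact ⟨0, fun h1 h2 => absurd ⟨h1, h2⟩ hj⟩
  choose φ hφ using hex
  have hn : 1 ≤ P.n := P.hn
  refine ⟨φ, fun j h1 h2 => (hφ j h1 h2).1, fun j h1 h2 => (hφ j h1 h2).2.1,
    fun j h1 h2 => (hφ j h1 h2).2.2, fun j h1 h2 => ?_, ?_, ?_⟩
  · rw [← (hφ (j + 1) (by omega) (by omega)).2.1, ← (hφ j h1 h2.le).2.1]
    exact hv.pdx_glue hi1 hi2 h1 h2 hx
  · rw [← (hφ 1 le_rfl hn).2.1]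
    exact hv.pdx_bot hi1 hi2 hx
  · rw [← (hφ P.n hn le_rfl).2.1]
    exact hv.pdx_top hi1 hi2 hx

lemma IsPiOf.jumpXY_of_fst_ne_last (hr : 1 ≤ r) (hG : IsGaussPoints r G)
    (hA : IsGaussWeights r G A) (hv : IsTrialFun r P v) (hw : IsPiOf r G A P v w)
    {i k j l : ℕ} (hi1 : 1 ≤ i) (hi2 : i ≤ P.m) (hk1 : 1 ≤ k) (hk2 : k ≤ r)
    (hj1 : 1 ≤ j) (hj2 : j ≤ P.n) (hl1 : 1 ≤ l) (hl2 : l ≤ r) (hik : ¬(i = P.m ∧ k = r)) :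
    jumpXY r w i k j l = (P.hx i * A k / 2) * (P.hy j * A l / 2) *
      pdy (pdx (v.cellFun i j)) (P.gx r G i k, P.gy r G j l) := by
  obtain ⟨φ, hdeg, -, hφ', hglue, h0, hn⟩ :=
    hv.exists_slice hi1 hi2 (P.gx_mem hG hi1 hi2 hk1 hk2)
  rw [← jumpX_sub_jumpX, hφ' j hj1 hj2, P.gy_of_le G j hl2]
  refine (increment_eq_of_forall_ne_last hr hG hA P.n P.hn P.y φ hdeg hglue h0 hn
    (fun j l => jumpX r w i k j l) (jumpX_snd_zero r w i k) (hw.1.jumpX_snd_last hr hi1 hi2 hk2)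
    (fun j h1 _ => jumpX_snd_glue hr w i k h1) (P.hx i * A k / 2) ?_ j hj1 hj2 l hl1 hl2).trans ?_
  · intro j hj1 hj2 l hl1 hl2 hjl
    rw [jumpX_sub_jumpX, hw.2 i (Finset.mem_Icc.mpr ⟨hi1, hi2⟩) k (Finset.mem_Icc.mpr ⟨hk1, hk2⟩)
      j (Finset.mem_Icc.mpr ⟨hj1, hj2⟩) l (Finset.mem_Icc.mpr ⟨hl1, hl2⟩) hik hjl,
      hφ' j hj1 hj2, P.gy_of_le G j hl2, RectPartition.hy, mul_assoc]
  · rw [RectPartition.hy, mul_assoc]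

lemma IsPiOf.jumpXY_of_snd_ne_last (hr : 1 ≤ r) (hG : IsGaussPoints r G)
    (hA : IsGaussWeights r G A) (hv : IsTrialFun r P v) (hw : IsPiOf r G A P v w)
    {i k j l : ℕ} (hi1 : 1 ≤ i) (hi2 : i ≤ P.m) (hk1 : 1 ≤ k) (hk2 : k ≤ r)
    (hj1 : 1 ≤ j) (hj2 : j ≤ P.n) (hl1 : 1 ≤ l) (hl2 : l ≤ r) (hjl : ¬(j = P.n ∧ l = r)) :
    jumpXY r w i k j l = (P.hx i * A k / 2) * (P.hy j * A l / 2) *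
      pdy (pdx (v.cellFun i j)) (P.gx r G i k, P.gy r G j l) := by
  have h := (hw.swap hv).jumpXY_of_fst_ne_last hr hG hA hv.swap hj1 hj2 hl1 hl2 hi1 hi2 hk1 hk2
    hjl
  have hb := hv.2.2 i (Finset.mem_Icc.mpr ⟨hi1, hi2⟩) j (Finset.mem_Icc.mpr ⟨hj1, hj2⟩)
  have hx : pdx (v.swap.cellFun j i) = fun z => pdy (v.cellFun i j) z.swap :=
    funext fun z => pdx_comp_swap (v.cellFun i j) z
  rw [jumpXY_swap, hx, pdy_comp_swap, ← pdy_pdx_comm hb.contDiff] at h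
  rw [h]
  change (P.hy j * A l / 2) * (P.hx i * A k / 2) *
    pdy (pdx (v.cellFun i j)) (P.gx r G i k, P.gy r G j l) = _
  ring

/-- The part of the bilinear form coming from vertical Gauss lines. -/
noncomputable def xForm (r : ℕ) (G : ℕ → ℝ) (P : RectPartition a b c d) (α : ℝ × ℝ → ℝ)
    (Dxv : ℕ → ℕ → ℝ × ℝ → ℝ) (w : ℕ → ℕ → ℕ → ℕ → ℝ) : ℝ :=
  ∑ q ∈ idxX r P,
    jumpX r w q.1 q.2.1 q.2.2.1 q.2.2.2 *
      ((∫ t in (P.gy r G q.2.2.1 q.2.2.2)..(min (P.gy r G q.2.2.1 (q.2.2.2 + 1)) (P.y q.2.2.1)),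
          α (P.gx r G q.1 q.2.1, t) * Dxv q.1 q.2.2.1 (P.gx r G q.1 q.2.1, t)) +
       (∫ t in (P.y q.2.2.1)..(max (P.gy r G q.2.2.1 (q.2.2.2 + 1)) (P.y q.2.2.1)),
          α (P.gx r G q.1 q.2.1, t) * Dxv q.1 (q.2.2.1 + 1) (P.gx r G q.1 q.2.1, t)))

lemma integral_mul_eval_eq_sub {β : ℝ → ℝ} {κ u v : ℝ} (hβ : ∀ t ∈ Set.Ioo u v, β t = κ)
    {φ F : ℝ[X]} (hF : derivative F = C κ * φ) {p q : ℝ} (hp : u ≤ p) (hpq : p ≤ q) (hq : q ≤ v) :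
    ∫ t in p..q, β t * φ.eval t = F.eval q - F.eval p := by
  rw [← integral_eval_derivative, hF]
  refine intervalIntegral.integral_congr_Ioo_of_le hpq fun t ht => ?_
  simp only [eval_mul, eval_C]
  rw [hβ t ⟨hp.trans_lt ht.1, ht.2.trans_le hq⟩]

lemma setIntegral_pdx_sq (hG : IsGaussPoints r G) (hA : IsGaussWeights r G A) (hr : 1 ≤ r)
    {f : ℝ × ℝ → ℝ} (hf : IsBiPoly r f) {u u' s s' : ℝ} (hu : u ≤ u') (hs : s ≤ s') :
    ∫ z in Set.Icc u u' ×ˢ Set.Icc s s', (pdx f z) ^ 2 =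
      ∑ k ∈ Finset.Icc 1 r, (u' - u) * A k / 2 *
        ∫ t in s..s', (pdx f ((u' + u + (u' - u) * G k) / 2, t)) ^ 2 := by
  have hcont : Continuous (pdx f) := (contDiff_pdx hf.contDiff).continuous
  have hswap := setIntegral_prod_swap (μ := (volume : Measure ℝ)) (ν := (volume : Measure ℝ))
    (Set.Icc u u') (Set.Icc s s') (fun z => (pdx f z) ^ 2)
  rw [Measure.volume_eq_prod, ← hswap, setIntegral_prod]
  · have hinner : ∀ t, ∫ x in Set.Icc u u', (pdx f (Prod.swap (t, x))) ^ 2 =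
        ∑ k ∈ Finset.Icc 1 r, (u' - u) * A k / 2 *
          (pdx f ((u' + u + (u' - u) * G k) / 2, t)) ^ 2 := by
      intro t
      obtain ⟨ψ, hdeg, hψ⟩ := hf.exists_pdx_fst_slice t
      have hex := gauss_quadrature_exact_interval hG hA (ψ ^ 2)
        (lt_of_le_of_lt natDegree_pow_le (by omega)) u u'
      simp only [Prod.swap_prod_mk, hψ]
      rw [integral_Icc_eq_integral_Ioc, ← intervalIntegral.integral_of_le hu]
      simpa only [eval_pow] using hex.symm
    simp only [hinner]
    rw [integral_Icc_eq_integral_Ioc, ← intervalIntegral.integral_of_le hs,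
      intervalIntegral.integral_finsetSum]
    · simp only [intervalIntegral.integral_const_mul]
    · intro k _
      apply Continuous.intervalIntegrable
      fun_prop
  · refine ContinuousOn.integrableOn_compact (isCompact_Icc.prod isCompact_Icc) ?_
    exact ((hcont.comp continuous_swap).pow 2).continuousOn

/-- The value of an integral over a Gauss subinterval lying inside one cell. -/
lemma gauss_segment_integral_interior (hG : IsGaussPoints r G) {β : ℝ → ℝ} {κ : ℕ → ℝ}
    (hβ : ∀ j, 1 ≤ j → j ≤ P.n → ∀ t ∈ Set.Ioo (P.y (j - 1)) (P.y j), β t = κ j)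
    {φ F : ℕ → ℝ[X]} (hF : ∀ j, derivative (F j) = C (κ j) * φ j) {D : ℕ → ℝ → ℝ}
    (hD : ∀ j, 1 ≤ j → j ≤ P.n → ∀ t, D j t = (φ j).eval t)
    {j l : ℕ} (hj1 : 1 ≤ j) (hj2 : j ≤ P.n) (hl1 : 1 ≤ l) (hl2 : l < r) :
    (∫ t in (P.gy r G j l)..(min (P.gy r G j (l + 1)) (P.y j)), β t * D j t) +
      (∫ t in (P.y j)..(max (P.gy r G j (l + 1)) (P.y j)), β t * D (j + 1) t) =
    (F j).eval (P.gy r G j (l + 1)) - (F j).eval (P.gy r G j l) := by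
  have h1 := P.gy_mem hG hj1 hj2 hl1 hl2.le
  have h2 := P.gy_mem hG hj1 hj2 (l := l + 1) (by omega) hl2
  have h12 : P.gy r G j l ≤ P.gy r G j (l + 1) := by
    rw [P.gy_of_le G j hl2.le, P.gy_of_le G j (l := l + 1) hl2]
    have := P.y_pred_lt hj1 hj2
    have := hG.1 l hl1 hl2
    nlinarith
  rw [min_eq_left h2.2.le, max_eq_right h2.2.le, intervalIntegral.integral_same, add_zero]
  simp only [hD j hj1 hj2]
  exact integral_mul_eval_eq_sub (hβ j hj1 hj2) (hF j) h1.1.le h12 h2.2.le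

/-- The value of an integral over a Gauss subinterval crossing a cell interface. -/
lemma gauss_segment_integral_crossing (hr : 1 ≤ r) (hG : IsGaussPoints r G) {β : ℝ → ℝ}
    {κ : ℕ → ℝ} (hβ : ∀ j, 1 ≤ j → j ≤ P.n → ∀ t ∈ Set.Ioo (P.y (j - 1)) (P.y j), β t = κ j)
    {φ F : ℕ → ℝ[X]} (hF : ∀ j, derivative (F j) = C (κ j) * φ j)
    (hFglue : ∀ j, (F (j + 1)).eval (P.y j) = (F j).eval (P.y j)) {D : ℕ → ℝ → ℝ}
    (hD : ∀ j, 1 ≤ j → j ≤ P.n → ∀ t, D j t = (φ j).eval t)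
    {j : ℕ} (hj1 : 1 ≤ j) (hj2 : j < P.n) :
    (∫ t in (P.gy r G j r)..(min (P.gy r G j (r + 1)) (P.y j)), β t * D j t) +
      (∫ t in (P.y j)..(max (P.gy r G j (r + 1)) (P.y j)), β t * D (j + 1) t) =
    (F (j + 1)).eval (P.gy r G j (r + 1)) - (F j).eval (P.gy r G j r) := by
  have h1 := P.gy_mem hG hj1 hj2.le hr le_rfl
  have h2 : P.gy r G j (r + 1) ∈ Set.Ioo (P.y j) (P.y (j + 1)) := by
    rw [P.gy_succ G hj2]
    exact gauss_node_mem_Ioo (P.hylt j hj2) (hG.2 1 le_rfl hr).1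
  rw [min_eq_right h2.1.le, max_eq_left h2.1.le]
  simp only [hD j hj1 hj2.le, hD (j + 1) (by omega) hj2]
  rw [integral_mul_eval_eq_sub (hβ j hj1 hj2.le) (hF j) h1.1.le h1.2.le le_rfl,
    integral_mul_eval_eq_sub (hβ (j + 1) (by omega) hj2) (hF (j + 1))
      (p := P.y j) (show P.y (j + 1 - 1) ≤ P.y j by rw [Nat.add_sub_cancel]) h2.1.le h2.2.le,
    hFglue]
  ring

/-- Coercivity of the part of the bilinear form coming from vertical Gauss lines. -/
lemma xForm_coercivity (hr : 1 ≤ r) (hG : IsGaussPoints r G) (hA : IsGaussWeights r G A)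
    {α : ℝ × ℝ → ℝ} {α₀ : ℝ} (hα₀ : 0 < α₀) (hpc : PiecewiseConstant P α)
    (hlb : ∀ z ∈ P.dom, α₀ ≤ α z) (hv : IsTrialFun r P v) (hw : IsPiOf r G A P v w) :
    α₀ * ∑ i ∈ Finset.Icc 1 P.m, ∑ j ∈ Finset.Icc 1 P.n,
        ∫ z in P.cell i j, (cellDx v i j z) ^ 2 ≤ xForm r G P α (cellDx v) w := by
  have hline : ∀ i ∈ Finset.Icc 1 P.m, ∀ k ∈ Finset.Icc 1 r,
      P.hx i * A k / 2 * ∑ j ∈ Finset.Icc 1 P.n, α₀ * ∫ t in (P.y (j - 1))..(P.y j),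
        (cellDx v i j (P.gx r G i k, t)) ^ 2 ≤
      ∑ j ∈ Finset.Icc 1 P.n, ∑ l ∈ Finset.Icc 1 r, jumpX r w i k j l *
        ((∫ t in (P.gy r G j l)..(min (P.gy r G j (l + 1)) (P.y j)),
          α (P.gx r G i k, t) * cellDx v i j (P.gx r G i k, t)) +
        (∫ t in (P.y j)..(max (P.gy r G j (l + 1)) (P.y j)),
          α (P.gx r G i k, t) * cellDx v i (j + 1) (P.gx r G i k, t))) := by
    intro i hi k hk
    have hpci := hpc i hi
    rw [Finset.mem_Icc] at hi hk
    have hgx := P.gx_mem hG hi.1 hi.2 hk.1 hk.2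
    obtain ⟨φ, hdeg, hφ, hφ', hglue, h0, hn⟩ := hv.exists_slice hi.1 hi.2 hgx
    choose! κ hκ using hpci
    have hβ : ∀ j, 1 ≤ j → j ≤ P.n → ∀ t ∈ Set.Ioo (P.y (j - 1)) (P.y j),
        α (P.gx r G i k, t) = κ j :=
      fun j h1 h2 t ht => hκ j (Finset.mem_Icc.mpr ⟨h1, h2⟩) _ ⟨hgx, ht⟩
    have hκ₀ : ∀ j, 1 ≤ j → j ≤ P.n → α₀ ≤ κ j := by
      intro j h1 h2
      have hgy := P.gy_mem hG h1 h2 le_rfl hr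
      rw [← hβ j h1 h2 _ hgy]
      exact hlb _ (P.cell_subset_dom hi.2 h2
        ⟨Set.Ioo_subset_Icc_self hgx, Set.Ioo_subset_Icc_self hgy⟩)
    obtain ⟨F, hF, hFglue⟩ := exists_glued_primitive (fun j => C (κ j) * φ j) P.y
    have hK : 0 ≤ P.hx i * A k / 2 :=
      div_nonneg (mul_nonneg (sub_nonneg.mpr (P.x_pred_lt hi.1 hi.2).le)
        (gauss_weight_nonneg hG hA hk.1 hk.2)) (by norm_num)
    refine le_trans (mul_le_mul_of_nonneg_left (Finset.sum_le_sum fun j hj => ?_) hK)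
      (one_dim_coercivity hr hG hA P.n P.hn P.y (fun j h1 h2 => (P.y_pred_lt h1 h2).le) φ F κ
        (fun j h1 h2 => hα₀.le.trans (hκ₀ j h1 h2)) hdeg hglue h0 hn hF hFglue
        (fun j l => jumpX r w i k j l) (jumpX_snd_zero r w i k)
        (hw.1.jumpX_snd_last hr hi.1 hi.2 hk.2) (fun j h1 _ => jumpX_snd_glue hr w i k h1)
        (P.hx i * A k / 2) hK ?_ _ ?_ ?_)
    · rw [Finset.mem_Icc] at hj
      simp only [cellDx, hφ j hj.1 hj.2]
      refine mul_le_mul_of_nonneg_right (hκ₀ j hj.1 hj.2) ?_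
      exact intervalIntegral.integral_nonneg (P.y_pred_lt hj.1 hj.2).le fun t _ => sq_nonneg _
    · intro j hj1 hj2 l hl1 hl2 hjl
      rw [jumpX_sub_jumpX, hw.jumpXY_of_snd_ne_last hr hG hA hv hi.1 hi.2 hk.1 hk.2 hj1 hj2 hl1 hl2
        hjl, hφ' j hj1 hj2, P.gy_of_le G j hl2, RectPartition.hy, mul_assoc]
    · intro j hj1 hj2 l hl1 hl2
      rw [← P.gy_of_le G j hl2.le, ← P.gy_of_le G j (l := l + 1) hl2]
      exact gauss_segment_integral_interior hG hβ hF
        (D := fun j t => cellDx v i j (P.gx r G i k, t)) hφ hj1 hj2 hl1 hl2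
    · intro j hj1 hj2
      rw [← P.gy_of_le G j le_rfl, ← P.gy_succ G hj2]
      exact gauss_segment_integral_crossing hr hG hβ hF hFglue
        (D := fun j t => cellDx v i j (P.gx r G i k, t)) hφ hj1 hj2
  have hform : xForm r G P α (cellDx v) w =
      ∑ i ∈ Finset.Icc 1 P.m, ∑ k ∈ Finset.Icc 1 r, ∑ j ∈ Finset.Icc 1 P.n,
      ∑ l ∈ Finset.Icc 1 r, jumpX r w i k j l *
        ((∫ t in (P.gy r G j l)..(min (P.gy r G j (l + 1)) (P.y j)),
          α (P.gx r G i k, t) * cellDx v i j (P.gx r G i k, t)) +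
        (∫ t in (P.y j)..(max (P.gy r G j (l + 1)) (P.y j)),
          α (P.gx r G i k, t) * cellDx v i (j + 1) (P.gx r G i k, t))) := by
    rw [xForm, idxX, Finset.sum_filter_of_ne]
    · simp only [Finset.sum_product]
    · rintro ⟨i, k, j, l⟩ hq hne ⟨hjn, hlr⟩
      simp only [Finset.mem_product, Finset.mem_Icc] at hq hjn hlr
      subst hjn hlr
      exact hne (by simp only [hw.1.jumpX_snd_last hr hq.1.1 hq.1.2 hq.2.1.2, zero_mul])
  rw [hform, Finset.mul_sum]
  refine Finset.sum_le_sum fun i hi => le_trans (le_of_eq ?_) (Finset.sum_le_sum (hline i hi))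
  simp only [Finset.mul_sum]
  rw [Finset.sum_comm]
  refine Finset.sum_congr rfl fun j hj => ?_
  have hb := hv.2.2 i hi j hj
  rw [Finset.mem_Icc] at hi hj
  rw [RectPartition.cell]
  simp only [cellDx]
  rw [setIntegral_pdx_sq hG hA hr hb (P.x_pred_lt hi.1 hi.2).le (P.y_pred_lt hj.1 hj.2).le,
    Finset.mul_sum]
  refine Finset.sum_congr rfl fun k hk => ?_
  rw [Finset.mem_Icc] at hk
  rw [P.gx_of_le G i hk.2, RectPartition.hx]
  ring

/-- The bilinear form is the sum of its vertical part and, after exchanging the coordinates,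
its horizontal part. -/
lemma aP_eq_xForm_add (α : ℝ × ℝ → ℝ) :
    aP r G P α (cellDx v) (cellDy v) w = xForm r G P α (cellDx v) w +
      xForm r G P.swap (fun z => α z.swap) (cellDx v.swap)
        (fun j l i k => w i k j l) := by
  have hD : cellDx v.swap = fun j i z => cellDy v i j z.swap :=
    funext fun j => funext fun i => funext fun z => pdx_comp_swap (v.cellFun i j) z
  rw [hD]
  unfold aP
  congr 1
  refine Finset.sum_nbij' (fun q => (q.2.2.1, q.2.2.2, q.1, q.2.1))
    (fun q => (q.2.2.1, q.2.2.2, q.1, q.2.1)) ?_ ?_ (fun _ _ => rfl) (fun _ _ => rfl) ?_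
  · intro q hq
    simp only [idxX, idxY, Finset.mem_filter, Finset.mem_product] at hq ⊢
    exact ⟨⟨hq.1.2.2.1, hq.1.2.2.2, hq.1.1, hq.1.2.1⟩, hq.2⟩
  · intro q hq
    simp only [idxX, idxY, Finset.mem_filter, Finset.mem_product] at hq ⊢
    exact ⟨⟨hq.1.2.2.1, hq.1.2.2.2, hq.1.1, hq.1.2.1⟩, hq.2⟩
  · intro q _
    simp only [jumpX_swap]
    rfl

lemma semiH1_sq (hv : IsTrialFun r P v) :
    (semiH1 P v) ^ 2 =
      (∑ i ∈ Finset.Icc 1 P.m, ∑ j ∈ Finset.Icc 1 P.n,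
        ∫ z in P.cell i j, (cellDx v i j z) ^ 2) +
      ∑ i ∈ Finset.Icc 1 P.m, ∑ j ∈ Finset.Icc 1 P.n,
        ∫ z in P.cell i j, (cellDy v i j z) ^ 2 := by
  rw [semiH1, Real.sq_sqrt (Finset.sum_nonneg fun i _ => Finset.sum_nonneg fun j _ =>
    integral_nonneg fun z => by positivity), ← Finset.sum_add_distrib]
  refine Finset.sum_congr rfl fun i hi => ?_
  rw [← Finset.sum_add_distrib]
  refine Finset.sum_congr rfl fun j hj => ?_
  have hfd : Continuous (fderiv ℝ (v.cellFun i j)) :=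
    (hv.2.2 i hi j hj).contDiff.continuous_fderiv (by norm_num)
  have hcompact : IsCompact (P.cell i j) := isCompact_Icc.prod isCompact_Icc
  refine integral_add ?_ ?_
  · exact ContinuousOn.integrableOn_compact hcompact
      ((hfd.clm_apply continuous_const).pow 2).continuousOn
  · exact ContinuousOn.integrableOn_compact hcompact
      ((hfd.clm_apply continuous_const).pow 2).continuousOn

end Coercivity


/-- Coercivity along the mapping `Π`: if `α` is piecewise constant with respect
to `P` and `α ≥ α₀ > 0`, then `a_P(v, Πv) ≥ α₀ |v|₁²` for every trial function `v`. -/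
theorem fvm_coercivity_piecewise_constant (r : ℕ) (hr : 1 ≤ r) (G A : ℕ → ℝ)
    (hG : IsGaussPoints r G) (hA : IsGaussWeights r G A)
    {a b c d : ℝ} (hab : a < b) (hcd : c < d) (P : RectPartition a b c d)
    (α : ℝ × ℝ → ℝ) (α₀ : ℝ) (hα₀ : 0 < α₀)
    (hpc : PiecewiseConstant P α) (hlb : ∀ z ∈ P.dom, α₀ ≤ α z)
    (v : PiecewiseFun P) (hv : IsTrialFun r P v)
    (w : ℕ → ℕ → ℕ → ℕ → ℝ) (hw : IsPiOf r G A P v w) :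
    α₀ * (semiH1 P v) ^ 2 ≤ aP r G P α (cellDx v) (cellDy v) w := by
  have hx := xForm_coercivity hr hG hA hα₀ hpc hlb hv hw
  have hy := xForm_coercivity hr hG hA hα₀ hpc.swap
    (fun z hz => hlb z.swap ⟨hz.2, hz.1⟩) hv.swap (hw.swap hv)
  have hsum : ∑ j ∈ Finset.Icc 1 P.swap.m, ∑ i ∈ Finset.Icc 1 P.swap.n,
        ∫ z in P.swap.cell j i, (cellDx v.swap j i z) ^ 2 =
      ∑ i ∈ Finset.Icc 1 P.m, ∑ j ∈ Finset.Icc 1 P.n,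
        ∫ z in P.cell i j, (cellDy v i j z) ^ 2 := by
    rw [Finset.sum_comm]
    refine Finset.sum_congr rfl fun i _ => Finset.sum_congr rfl fun j _ => ?_
    have hpd : ∀ z, cellDx v.swap j i z = cellDy v i j z.swap :=
      fun z => pdx_comp_swap (v.cellFun i j) z
    simp only [hpd]
    exact setIntegral_prod_swap (μ := (volume : Measure ℝ)) (ν := (volume : Measure ℝ))
      (Set.Icc (P.x (i - 1)) (P.x i)) (Set.Icc (P.y (j - 1)) (P.y j))
      (fun z => (cellDy v i j z) ^ 2)
  rw [hsum] at hy
  rw [semiH1_sq hv, mul_add, aP_eq_xForm_add]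
  exact add_le_add hx hy
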